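/- Let I : (0,1) → (0,1) be quasiconcave satisfying condition (★) and the condition that ∫_t^1 I(s)/s² ds ≤ C₀·(1/t)∫_0^t I(s)/s ds for some C₀ > 0 and all t ∈ (0,1). Let ‖·‖_X be an r.i. norm. Then there exist c₁, c₂ > 0 such that for every f ∈ M_+(0,1): c₁·‖f‖_{Y_X} ≤ sup{ ∫_0^1 (I(t)/t)·(f^{**}(t) − f^*(t))·g^*(t) dt : g ∈ M_+(0,1), ‖S_I g‖_{X'} ≤ 1 } + ‖f‖_1 ≤ c₂·‖f‖_{Y_X}. -/

import Mathlib

open MeasureTheory Set Filter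
open scoped ENNReal

noncomputable section

/-- The nonincreasing rearrangement of `f` over `(0,1)`. -/
def rearr (f : ℝ → ℝ≥0∞) (t : ℝ) : ℝ≥0∞ :=
  sInf {l : ℝ≥0∞ | volume {s ∈ Set.Ioo (0:ℝ) 1 | l < f s} ≤ ENNReal.ofReal t}

/-- The maximal nonincreasing rearrangement `f^{**}(t) = (1/t) ∫_0^t f^*(s) ds`. -/
def dstar (f : ℝ → ℝ≥0∞) (t : ℝ) : ℝ≥0∞ :=
  (ENNReal.ofReal t)⁻¹ * ∫⁻ s in Set.Ioo (0:ℝ) t, rearr f s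

/-- The `L¹(0,1)` norm. -/
def lOne (f : ℝ → ℝ≥0∞) : ℝ≥0∞ := ∫⁻ t in Set.Ioo (0:ℝ) 1, f t

/-- The norm of the Marcinkiewicz-type space `m_I`. -/
def mNorm (I : ℝ → ℝ) (f : ℝ → ℝ≥0∞) : ℝ≥0∞ :=
  ⨆ t ∈ Set.Ioo (0:ℝ) 1, ENNReal.ofReal (I t) * rearr f t

/-- The norm of `m_Ĩ` where `Ĩ(t) = t / I(t)`. -/
def mNormTilde (I : ℝ → ℝ) (f : ℝ → ℝ≥0∞) : ℝ≥0∞ :=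
  ⨆ t ∈ Set.Ioo (0:ℝ) 1, ENNReal.ofReal (t / I t) * rearr f t

/-- The supremum operator `S_I f(t) = (1/I(t)) sup_{0<s≤t} I(s) f^*(s)`. -/
def SI (I : ℝ → ℝ) (f : ℝ → ℝ≥0∞) : ℝ → ℝ≥0∞ := fun t =>
  (ENNReal.ofReal (I t))⁻¹ * ⨆ s ∈ Set.Ioc (0:ℝ) t, ENNReal.ofReal (I s) * rearr f s

/-- The supremum operator `T_I f(t) = (I(t)/t) sup_{t≤s<1} (s/I(s)) f^*(s)`. -/
def TI (I : ℝ → ℝ) (f : ℝ → ℝ≥0∞) : ℝ → ℝ≥0∞ := fun t =>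
  ENNReal.ofReal (I t / t) * ⨆ s ∈ Set.Ico t 1, ENNReal.ofReal (s / I s) * rearr f s

/-- `H_I f(t) = ∫_t^1 f(s)/I(s) ds`. -/
def HI (I : ℝ → ℝ) (f : ℝ → ℝ≥0∞) : ℝ → ℝ≥0∞ := fun t =>
  ∫⁻ s in Set.Ioo t 1, f s / ENNReal.ofReal (I s)

/-- `R_I f(t) = (1/I(t)) ∫_0^t f(s) ds`. -/
def RI (I : ℝ → ℝ) (f : ℝ → ℝ≥0∞) : ℝ → ℝ≥0∞ := fun t =>
  (ENNReal.ofReal (I t))⁻¹ * ∫⁻ s in Set.Ioo (0:ℝ) t, f s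

/-- `I : (0,1) → (0,1)` is quasiconcave: a nondecreasing bijection of `(0,1)` onto `(0,1)`
with `I(t)/t` nonincreasing, `I(0+) = 0` and `I(1-) = 1`. -/
def Quasiconcave (I : ℝ → ℝ) : Prop :=
  Set.BijOn I (Set.Ioo 0 1) (Set.Ioo 0 1) ∧
  MonotoneOn I (Set.Ioo 0 1) ∧
  AntitoneOn (fun t => I t / t) (Set.Ioo 0 1) ∧
  Tendsto I (nhdsWithin 0 (Set.Ioo 0 1)) (nhds 0) ∧
  Tendsto I (nhdsWithin 1 (Set.Ioo 0 1)) (nhds 1)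

/-- Condition (★): `∫_0^t I(s)/s ds ≲ I(t)`. -/
def StarCond (I : ℝ → ℝ) : Prop :=
  ∃ C : ℝ, 0 < C ∧ ∀ t ∈ Set.Ioo (0:ℝ) 1,
    ∫⁻ s in Set.Ioo (0:ℝ) t, ENNReal.ofReal (I s / s) ≤ ENNReal.ofReal (C * I t)

/-- The average property: `∫_0^t ds/I(s) ≲ t/I(t)`. -/
def AvgProp (I : ℝ → ℝ) : Prop :=
  ∃ C : ℝ, 0 < C ∧ ∀ t ∈ Set.Ioo (0:ℝ) 1,
    ∫⁻ s in Set.Ioo (0:ℝ) t, ENNReal.ofReal (1 / I s) ≤ ENNReal.ofReal (C * (t / I t))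

/-- The condition `∫_t^1 I(s)/s² ds ≲ (1/t) ∫_0^t I(s)/s ds`. -/
def MaxCond (I : ℝ → ℝ) : Prop :=
  ∃ C : ℝ, 0 < C ∧ ∀ t ∈ Set.Ioo (0:ℝ) 1,
    ∫⁻ s in Set.Ioo t 1, ENNReal.ofReal (I s / s ^ 2) ≤
      ENNReal.ofReal (C / t) * ∫⁻ s in Set.Ioo (0:ℝ) t, ENNReal.ofReal (I s / s)

/-- The class `𝒬` of quasiconcave functions. -/
def ClassQ (I : ℝ → ℝ) : Prop :=
  Quasiconcave I ∧ StarCond I ∧ AvgProp I ∧ MaxCond I ∧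
  ∃ c d : ℝ,
    IsLUB {l : ℝ | 0 ≤ l ∧ ∀ t ∈ Set.Ioo (0:ℝ) 1,
      ENNReal.ofReal (l * (I t / t ^ 2 - 1)) ≤
        ∫⁻ s in Set.Ioo t 1, ENNReal.ofReal (I s / s ^ 3)} c ∧
    IsLeast {e : ℝ | 0 < e ∧ ∀ t ∈ Set.Ioo (0:ℝ) 1,
      ∫⁻ s in Set.Ioo t 1, ENNReal.ofReal (I s / s ^ 2) ≤
        ENNReal.ofReal (e * (I t / t))} d ∧
    (1 - c) * d ≤ c

/-- The `Δ₂` condition: `I(2t) ≤ C I(t)` for `t ∈ (0,1/2)`. -/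
def Delta2 (I : ℝ → ℝ) : Prop :=
  ∃ C : ℝ, 0 < C ∧ ∀ t ∈ Set.Ioo (0:ℝ) (1/2), I (2 * t) ≤ C * I t

/-- A rearrangement-invariant Banach function norm on `M₊(0,1)`. -/
def IsRiNorm (ρ : (ℝ → ℝ≥0∞) → ℝ≥0∞) : Prop :=
  (∀ f : ℝ → ℝ≥0∞, Measurable f →
      (ρ f = 0 ↔ f =ᵐ[volume.restrict (Set.Ioo (0:ℝ) 1)] 0)) ∧
  (∀ f : ℝ → ℝ≥0∞, Measurable f → ∀ a : ℝ, 0 ≤ a →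
      ρ (fun t => ENNReal.ofReal a * f t) = ENNReal.ofReal a * ρ f) ∧
  (∀ f g : ℝ → ℝ≥0∞, Measurable f → Measurable g →
      ρ (fun t => f t + g t) ≤ ρ f + ρ g) ∧
  (∀ f g : ℝ → ℝ≥0∞, Measurable f → Measurable g →
      (∀ᵐ t ∂(volume.restrict (Set.Ioo (0:ℝ) 1)), f t ≤ g t) → ρ f ≤ ρ g) ∧
  (∀ (fn : ℕ → ℝ → ℝ≥0∞) (f : ℝ → ℝ≥0∞), (∀ n, Measurable (fn n)) → Measurable f →
      (∀ᵐ t ∂(volume.restrict (Set.Ioo (0:ℝ) 1)), Monotone (fun n => fn n t)) →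
      (∀ᵐ t ∂(volume.restrict (Set.Ioo (0:ℝ) 1)), (⨆ n, fn n t) = f t) →
      (⨆ n, ρ (fn n)) = ρ f) ∧
  (ρ (fun _ => 1) < ⊤) ∧
  (∃ c : ℝ, 0 < c ∧ ∀ f : ℝ → ℝ≥0∞, Measurable f →
      ∫⁻ t in Set.Ioo (0:ℝ) 1, f t ≤ ENNReal.ofReal c * ρ f) ∧
  (∀ f : ℝ → ℝ≥0∞, Measurable f → ρ f = ρ (rearr f))

/-- The associate norm `ρ'`. -/
def assoc (ρ : (ℝ → ℝ≥0∞) → ℝ≥0∞) (f : ℝ → ℝ≥0∞) : ℝ≥0∞ :=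
  ⨆ (g : ℝ → ℝ≥0∞) (_ : Measurable g ∧ ρ g ≤ 1),
    ∫⁻ t in Set.Ioo (0:ℝ) 1, f t * g t

/-- The optimal target norm `‖f‖_{Y_X}` of the r.i. norm `ρ = ‖·‖_X` under `H_I`. -/
def optTargetNorm (I : ℝ → ℝ) (ρ : (ℝ → ℝ≥0∞) → ℝ≥0∞) (f : ℝ → ℝ≥0∞) : ℝ≥0∞ :=
  ⨆ (g : ℝ → ℝ≥0∞) (_ : Measurable g ∧ assoc ρ (RI I (rearr g)) ≤ 1),
    ∫⁻ t in Set.Ioo (0:ℝ) 1, rearr f t * rearr g t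

/-- The optimal domain norm `‖f‖_{X_Y} = sup_{h ∼ f} ‖H_I h‖_Y`. -/
def optDomainNorm (I : ℝ → ℝ) (ρY : (ℝ → ℝ≥0∞) → ℝ≥0∞) (f : ℝ → ℝ≥0∞) : ℝ≥0∞ :=
  ⨆ (h : ℝ → ℝ≥0∞)
    (_ : Measurable h ∧ ∀ t ∈ Set.Ioo (0:ℝ) 1, rearr h t = rearr f t),
      ρY (HI I h)

/-- `H_I : X → Y` boundedly. -/
def HIBounded (I : ℝ → ℝ) (ρX ρY : (ℝ → ℝ≥0∞) → ℝ≥0∞) : Prop :=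
  ∃ C : ℝ, 0 < C ∧ ∀ f : ℝ → ℝ≥0∞, Measurable f →
    ρY (HI I f) ≤ ENNReal.ofReal C * ρX f

/-- `X` is the optimal domain space for `Y` under `H_I`. -/
def IsOptimalDomain (I : ℝ → ℝ) (ρX ρY : (ℝ → ℝ≥0∞) → ℝ≥0∞) : Prop :=
  HIBounded I ρX ρY ∧
  ∀ ρZ : (ℝ → ℝ≥0∞) → ℝ≥0∞, IsRiNorm ρZ → HIBounded I ρZ ρY →
    ∃ C : ℝ, 0 < C ∧ ∀ f : ℝ → ℝ≥0∞, Measurable f →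
      ρX f ≤ ENNReal.ofReal C * ρZ f

/-- `Y` is the optimal target space for `X` under `H_I`. -/
def IsOptimalTarget (I : ℝ → ℝ) (ρX ρY : (ℝ → ℝ≥0∞) → ℝ≥0∞) : Prop :=
  HIBounded I ρX ρY ∧
  ∀ ρZ : (ℝ → ℝ≥0∞) → ℝ≥0∞, IsRiNorm ρZ → HIBounded I ρX ρZ →
    ∃ C : ℝ, 0 < C ∧ ∀ f : ℝ → ℝ≥0∞, Measurable f →
      ρZ f ≤ ENNReal.ofReal C * ρY f

lemma rearr_antitone (f : ℝ → ℝ≥0∞) : Antitone (rearr f) := by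
  intro s t hst
  unfold rearr
  apply sInf_le_sInf
  intro l hl
  exact le_trans hl (ENNReal.ofReal_le_ofReal hst)

lemma rearr_measurable (f : ℝ → ℝ≥0∞) : Measurable (rearr f) := (rearr_antitone f).measurable

lemma rearr_le_iff (f : ℝ → ℝ≥0∞) (t : ℝ) (l : ℝ≥0∞) :
    rearr f t ≤ l ↔ volume {s ∈ Set.Ioo (0:ℝ) 1 | l < f s} ≤ ENNReal.ofReal t := by
  constructor
  · intro h
    rcases eq_or_ne l ⊤ with rfl | hl
    · simp
    obtain ⟨u, hu, hul, hut⟩ := exists_seq_strictAnti_tendsto' (lt_top_iff_ne_top.2 hl)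
    have hset : {s ∈ Set.Ioo (0:ℝ) 1 | l < f s} = ⋃ n, {s ∈ Set.Ioo (0:ℝ) 1 | u n < f s} := by
      ext s
      simp only [mem_ofPred_eq, mem_iUnion]
      constructor
      · rintro ⟨h1, h2⟩
        obtain ⟨n, hn⟩ := (hut.eventually (gt_mem_nhds h2)).exists
        exact ⟨n, h1, hn⟩
      · rintro ⟨n, h1, h2⟩
        exact ⟨h1, (hul n).1.trans h2⟩
    rw [hset, Monotone.measure_iUnion]
    · refine iSup_le fun n => ?_
      have : rearr f t < u n := lt_of_le_of_lt h (hul n).1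
      obtain ⟨l', hl', hlt⟩ := sInf_lt_iff.1 this
      refine le_trans (measure_mono ?_) hl'
      intro s hs
      exact ⟨hs.1, hlt.trans hs.2⟩
    · intro m n hmn s hs
      exact ⟨hs.1, lt_of_le_of_lt (hu.antitone hmn) hs.2⟩
  · intro h
    exact sInf_le h

lemma distr_rearr (f : ℝ → ℝ≥0∞) (l : ℝ≥0∞) :
    volume {s ∈ Set.Ioo (0:ℝ) 1 | l < rearr f s} = volume {s ∈ Set.Ioo (0:ℝ) 1 | l < f s} := by
  set m := volume {s ∈ Set.Ioo (0:ℝ) 1 | l < f s} with hm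
  have hm1 : m ≤ 1 := by
    calc m ≤ volume (Set.Ioo (0:ℝ) 1) := measure_mono (fun s hs => hs.1)
      _ = 1 := by simp
  have hmt : m ≠ ⊤ := ne_top_of_le_ne_top ENNReal.one_ne_top hm1
  have : {s ∈ Set.Ioo (0:ℝ) 1 | l < rearr f s} = Set.Ioo 0 m.toReal := by
    ext s
    simp only [mem_ofPred_eq, mem_Ioo]
    have hm1' : m.toReal ≤ 1 := by
      have := ENNReal.toReal_mono ENNReal.one_ne_top hm1
      simpa using this
    constructor
    · rintro ⟨⟨h0, h1⟩, h2⟩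
      refine ⟨h0, ?_⟩
      rw [← not_le, rearr_le_iff, not_le] at h2
      rw [← ENNReal.ofReal_lt_iff_lt_toReal h0.le hmt]
      exact h2
    · rintro ⟨h0, h1⟩
      refine ⟨⟨h0, by linarith⟩, ?_⟩
      rw [← not_le, rearr_le_iff, not_le]
      rw [← ENNReal.ofReal_lt_iff_lt_toReal h0.le hmt] at h1
      exact h1
  rw [this]
  simp [hmt]

lemma lintegral_rearr (f : ℝ → ℝ≥0∞) (hf : Measurable f) :
    ∫⁻ t in Set.Ioo (0:ℝ) 1, rearr f t = lOne f := by
  unfold lOne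
  have hmap : Measure.map (rearr f) (volume.restrict (Set.Ioo (0:ℝ) 1)) =
      Measure.map f (volume.restrict (Set.Ioo (0:ℝ) 1)) := by
    apply Measure.ext_of_Iic
    intro a
    rw [← compl_Ioi, measure_compl measurableSet_Ioi (measure_ne_top _ _),
      measure_compl measurableSet_Ioi (measure_ne_top _ _),
      Measure.map_apply (rearr_measurable f) MeasurableSet.univ,
      Measure.map_apply hf MeasurableSet.univ,
      Measure.map_apply (rearr_measurable f) measurableSet_Ioi,
      Measure.map_apply hf measurableSet_Ioi, 
      Measure.restrict_apply (rearr_measurable f measurableSet_Ioi),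
      Measure.restrict_apply (hf measurableSet_Ioi)]
    have h := distr_rearr f a
    have e1 : ∀ g : ℝ → ℝ≥0∞, g ⁻¹' Ioi a ∩ Ioo 0 1 = {s ∈ Set.Ioo (0:ℝ) 1 | a < g s} := by
      intro g; ext s; simp [and_comm]
    rw [e1, e1, h]
    simp
  have h1 : ∀ g : ℝ → ℝ≥0∞, Measurable g → ∫⁻ t in Set.Ioo (0:ℝ) 1, g t =
      ∫⁻ y, y ∂(Measure.map g (volume.restrict (Set.Ioo (0:ℝ) 1))) := by
    intro g hg
    rw [lintegral_map measurable_id' hg]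
  rw [h1 _ (rearr_measurable f), h1 _ hf, hmap]

lemma rearr_le_of_antitoneOn {k : ℝ → ℝ≥0∞} (hk : AntitoneOn k (Set.Ioo 0 1)) {t : ℝ}
    (ht : t ∈ Set.Ioo (0:ℝ) 1) : rearr k t ≤ k t := by
  rw [rearr_le_iff]
  calc volume {s ∈ Set.Ioo (0:ℝ) 1 | k t < k s} ≤ volume (Set.Ioo 0 t) := by
        apply measure_mono
        rintro s ⟨hs, hlt⟩
        refine ⟨hs.1, ?_⟩
        by_contra hcon
        exact absurd hlt (not_lt.2 (hk ht hs (not_lt.1 hcon)))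
    _ = ENNReal.ofReal t := by simp

lemma le_rearr_of_antitoneOn {k : ℝ → ℝ≥0∞} (hk : AntitoneOn k (Set.Ioo 0 1)) {t t' : ℝ}
    (ht : 0 < t) (htt : t < t') (ht' : t' < 1) : k t' ≤ rearr k t := by
  by_contra hcon
  rw [not_le] at hcon
  have h := (rearr_le_iff k t (rearr k t)).1 le_rfl
  have h2 : volume (Set.Ioo 0 t') ≤ volume {s ∈ Set.Ioo (0:ℝ) 1 | rearr k t < k s} := by
    apply measure_mono
    intro s hs
    refine ⟨⟨hs.1, hs.2.trans ht'⟩, lt_of_lt_of_le hcon ?_⟩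
    exact hk ⟨hs.1, hs.2.trans ht'⟩ ⟨ht.trans htt, ht'⟩ hs.2.le
  have h3 := h2.trans h
  simp only [Real.volume_Ioo, sub_zero] at h3
  rw [ENNReal.ofReal_le_ofReal_iff ht.le] at h3
  linarith

lemma rearr_ae_eq_of_antitoneOn {k : ℝ → ℝ≥0∞} (hk : AntitoneOn k (Set.Ioo 0 1)) :
    ∀ᵐ t ∂(volume.restrict (Set.Ioo (0:ℝ) 1)), rearr k t = k t := by
  have hc := hk.countable_not_continuousWithinAt
  rw [ae_restrict_iff' measurableSet_Ioo]
  filter_upwards [hc.ae_notMem volume] with t hnt ht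
  apply le_antisymm (rearr_le_of_antitoneOn hk ht)
  have hct : ContinuousWithinAt k (Set.Ioo 0 1) t := by
    by_contra hcon
    exact hnt ⟨ht, hcon⟩
  have h1 : Tendsto k (nhdsWithin t (Set.Ioo t 1)) (nhds (k t)) :=
    hct.mono_left (nhdsWithin_mono _ (fun s hs => ⟨ht.1.trans hs.1, hs.2⟩))
  have hne : (nhdsWithin t (Set.Ioo t 1)).NeBot := by
    apply mem_closure_iff_nhdsWithin_neBot.1
    rw [closure_Ioo ht.2.ne]
    exact ⟨le_rfl, ht.2.le⟩
  refine le_of_tendsto h1 ?_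
  filter_upwards [self_mem_nhdsWithin] with s hs
  exact le_rearr_of_antitoneOn hk ht.1 hs.1 hs.2

lemma assoc_mono {ρ : (ℝ → ℝ≥0∞) → ℝ≥0∞} {f g : ℝ → ℝ≥0∞}
    (h : ∀ t ∈ Set.Ioo (0:ℝ) 1, f t ≤ g t) : assoc ρ f ≤ assoc ρ g := by
  unfold assoc
  refine iSup₂_mono fun v hv => ?_
  refine setLIntegral_mono' measurableSet_Ioo fun t ht => ?_
  gcongr
  exact h t ht

lemma assoc_const_mul_le {ρ : (ℝ → ℝ≥0∞) → ℝ≥0∞} {f : ℝ → ℝ≥0∞} {a : ℝ≥0∞} (ha : a ≠ ⊤) :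
    assoc ρ (fun t => a * f t) ≤ a * assoc ρ f := by
  unfold assoc
  refine iSup₂_le fun v hv => ?_
  simp_rw [mul_assoc]
  rw [lintegral_const_mul' _ _ ha]
  gcongr
  exact le_iSup₂ (f := fun (g : ℝ → ℝ≥0∞) (_ : Measurable g ∧ ρ g ≤ 1) =>
    ∫⁻ t in Set.Ioo (0:ℝ) 1, f t * g t) v hv

/-- Tonelli on a triangle. -/
lemma tonelli_triangle {F φ : ℝ → ℝ≥0∞} (hF : Measurable F) (hφ : Measurable φ) (a T : ℝ) :
    ∫⁻ s in Set.Ioo a T, F s * ∫⁻ r in Set.Ioo s T, φ r =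
      ∫⁻ r in Set.Ioo a T, φ r * ∫⁻ s in Set.Ioo a r, F s := by
  have key : ∀ s r : ℝ, (Set.Ioo a T).indicator (1 : ℝ → ℝ≥0∞) s * (Set.Ioo s T).indicator (1 : ℝ → ℝ≥0∞) r =
      (Set.Ioo a T).indicator (1 : ℝ → ℝ≥0∞) r * (Set.Ioo a r).indicator (1 : ℝ → ℝ≥0∞) s := by
    intro s r
    simp only [indicator, mem_Ioo, Pi.one_apply]
    by_cases h1 : a < s <;> by_cases h2 : s < T <;> by_cases h3 : s < r <;>
      by_cases h4 : r < T <;> by_cases h5 : a < r <;> simp [h1, h2, h3, h4, h5] <;> linarith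
  have e : ∀ (S : Set ℝ) (g : ℝ → ℝ≥0∞), MeasurableSet S →
      ∫⁻ s in S, g s = ∫⁻ s, S.indicator 1 s * g s := by
    intro S g hS
    rw [← lintegral_indicator hS]
    congr 1; ext s
    by_cases h : s ∈ S <;> simp [h]
  have hm1 : Measurable (Function.uncurry fun s r : ℝ => (Set.Ioo s T).indicator (1 : ℝ → ℝ≥0∞) r) := by
    have : (Function.uncurry fun s r : ℝ => (Set.Ioo s T).indicator (1 : ℝ → ℝ≥0∞) r) =
        ({p : ℝ × ℝ | p.1 < p.2 ∧ p.2 < T}).indicator 1 := by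
      ext ⟨s, r⟩
      simp [indicator, Function.uncurry]
    rw [this]
    apply measurable_one.indicator
    exact (measurableSet_lt measurable_fst measurable_snd).inter
      (measurableSet_lt measurable_snd measurable_const)
  have hiT : Measurable ((Set.Ioo a T).indicator (1 : ℝ → ℝ≥0∞)) :=
    measurable_one.indicator measurableSet_Ioo
  calc ∫⁻ s in Set.Ioo a T, F s * ∫⁻ r in Set.Ioo s T, φ r
      = ∫⁻ s, ∫⁻ r, ((Set.Ioo a T).indicator 1 s * (Set.Ioo s T).indicator 1 r) * (F s * φ r) := by
        rw [e _ _ measurableSet_Ioo]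
        congr 1; ext s
        rw [e _ _ measurableSet_Ioo, ← mul_assoc, ← lintegral_const_mul]
        · congr 1; ext r; ring
        · exact (measurable_one.indicator measurableSet_Ioo).mul hφ
    _ = ∫⁻ r, ∫⁻ s, ((Set.Ioo a T).indicator 1 s * (Set.Ioo s T).indicator 1 r) * (F s * φ r) := by
        apply lintegral_lintegral_swap
        apply Measurable.aemeasurable
        apply Measurable.mul
        · exact (hiT.comp measurable_fst).mul hm1
        · exact (hF.comp measurable_fst).mul (hφ.comp measurable_snd)
    _ = ∫⁻ r in Set.Ioo a T, φ r * ∫⁻ s in Set.Ioo a r, F s := by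
        rw [e _ _ measurableSet_Ioo]
        congr 1; ext r
        rw [e _ _ measurableSet_Ioo, ← mul_assoc, ← lintegral_const_mul]
        · congr 1; ext s
          rw [key]; ring
        · exact (measurable_one.indicator measurableSet_Ioo).mul hF

lemma lintegral_inv_sq {a b : ℝ} (ha : 0 < a) (hab : a ≤ b) :
    ∫⁻ r in Set.Ioo a b, (ENNReal.ofReal r)⁻¹ * (ENNReal.ofReal r)⁻¹ =
      ENNReal.ofReal (1 / a - 1 / b) := by
  have h1 : ∫⁻ r in Set.Ioo a b, (ENNReal.ofReal r)⁻¹ * (ENNReal.ofReal r)⁻¹ =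
      ∫⁻ r in Set.Ioc a b, ENNReal.ofReal (r ^ (-2 : ℤ)) := by
    rw [setLIntegral_congr (Ioo_ae_eq_Ioc (μ := volume) (a := a) (b := b))]
    refine setLIntegral_congr_fun measurableSet_Ioc fun r hr => ?_
    have hr0 : 0 < r := ha.trans hr.1
    rw [← ENNReal.ofReal_inv_of_pos hr0, ← ENNReal.ofReal_mul (by positivity)]
    congr 1
    rw [zpow_neg, ← mul_inv]; norm_cast; ring_nf
  have hint : IntervalIntegrable (fun r : ℝ => r ^ (-2 : ℤ)) volume a b := by
    apply ContinuousOn.intervalIntegrable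
    intro x hx
    rw [uIcc_of_le hab] at hx
    apply ContinuousAt.continuousWithinAt
    exact continuousAt_zpow₀ _ _ (Or.inl (ne_of_gt (ha.trans_le hx.1)))
  rw [h1, ← ofReal_integral_eq_lintegral_ofReal, ← intervalIntegral.integral_of_le hab,
    integral_zpow]
  · congr 1
    norm_num
    ring
  · right
    refine ⟨by norm_num, ?_⟩
    rw [uIcc_of_le hab]
    intro h
    exact absurd h.1 (not_le.2 ha)
  · exact (intervalIntegrable_iff_integrableOn_Ioc_of_le hab).1 hint
  · rw [EventuallyLE, ae_restrict_iff' measurableSet_Ioc]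
    filter_upwards with r hr
    have hr0 : 0 < r := ha.trans hr.1
    simp only [Pi.zero_apply]
    positivity
/-- The weight `1/t²`. -/
def qw (t : ℝ) : ℝ≥0∞ := (ENNReal.ofReal t)⁻¹ * (ENNReal.ofReal t)⁻¹

lemma einv_measurable : Measurable (fun t : ℝ => (ENNReal.ofReal t)⁻¹) :=
  ENNReal.measurable_ofReal.inv

lemma qw_measurable : Measurable qw := einv_measurable.mul einv_measurable

lemma einv_ne_top {t : ℝ} (ht : 0 < t) : (ENNReal.ofReal t)⁻¹ ≠ ⊤ := by
  simp [ht]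

lemma einv_mul {t : ℝ} (ht : 0 < t) : (ENNReal.ofReal t)⁻¹ * ENNReal.ofReal t = 1 :=
  ENNReal.inv_mul_cancel (by simp [ht]) ENNReal.ofReal_ne_top

lemma lintegral_qw {a b : ℝ} (ha : 0 < a) (hab : a ≤ b) :
    (∫⁻ r in Set.Ioo a b, qw r) + (ENNReal.ofReal b)⁻¹ = (ENNReal.ofReal a)⁻¹ := by
  have hb : 0 < b := ha.trans_le hab
  unfold qw
  rw [lintegral_inv_sq ha hab, ← ENNReal.ofReal_inv_of_pos ha, ← ENNReal.ofReal_inv_of_pos hb,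
    ← ENNReal.ofReal_add]
  · congr 1
    simp
  · have := one_div_le_one_div_of_le ha hab
    linarith
  · positivity

lemma lintegral_split (g : ℝ → ℝ≥0∞) {a b c : ℝ} (hab : a < b) (hbc : b < c) :
    ∫⁻ r in Set.Ioo a c, g r = (∫⁻ r in Set.Ioo a b, g r) + ∫⁻ r in Set.Ioo b c, g r := by
  rw [← setLIntegral_congr (Ioo_ae_eq_Ico (μ := volume) (a := b) (b := c)).symm, 
    ← lintegral_union measurableSet_Ico, Ioo_union_Ico_eq_Ioo hab hbc.le]
  rw [Set.disjoint_left]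
  intro x hx hx'
  exact absurd hx.2 (not_lt.2 hx'.1)

lemma cumul_mono (g : ℝ → ℝ≥0∞) : Monotone (fun t : ℝ => ∫⁻ s in Set.Ioo (0:ℝ) t, g s) :=
  fun _ _ h => lintegral_mono_set (Ioo_subset_Ioo le_rfl h)

lemma tail_anti (g : ℝ → ℝ≥0∞) : Antitone (fun t : ℝ => ∫⁻ s in Set.Ioo t 1, g s) :=
  fun _ _ h => lintegral_mono_set (Ioo_subset_Ioo h le_rfl)

lemma dstar_measurable (f : ℝ → ℝ≥0∞) : Measurable (dstar f) :=
  einv_measurable.mul (cumul_mono _).measurable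

lemma rearr_le_dstar (f : ℝ → ℝ≥0∞) {t : ℝ} (ht : 0 < t) : rearr f t ≤ dstar f t := by
  unfold dstar
  calc rearr f t = (ENNReal.ofReal t)⁻¹ * (rearr f t * ENNReal.ofReal t) := by
        rw [mul_comm (rearr f t), ← mul_assoc, einv_mul ht, one_mul]
    _ = (ENNReal.ofReal t)⁻¹ * ∫⁻ s in Set.Ioo (0:ℝ) t, rearr f t := by simp
    _ ≤ _ := by
        refine mul_le_mul_right ?_ _
        exact setLIntegral_mono' measurableSet_Ioo fun s hs => rearr_antitone f hs.2.le

lemma dstar_le {f : ℝ → ℝ≥0∞} (hfin : ∫⁻ t in Set.Ioo (0:ℝ) 1, rearr f t ≠ ⊤) {s : ℝ}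
    (hs : s ∈ Set.Ioo (0:ℝ) 1) :
    dstar f s ≤ (∫⁻ t in Set.Ioo s 1, (ENNReal.ofReal t)⁻¹ * (dstar f t - rearr f t)) +
      ∫⁻ t in Set.Ioo (0:ℝ) 1, rearr f t := by
  have hF := rearr_measurable f
  have hmF : Measurable fun t : ℝ => (ENNReal.ofReal t)⁻¹ * rearr f t := einv_measurable.mul hF
  set A := ∫⁻ t in Set.Ioo (0:ℝ) s, rearr f t with hA
  set B := ∫⁻ t in Set.Ioo s 1, (ENNReal.ofReal t)⁻¹ * rearr f t with hB
  have hBfin : B ≠ ⊤ := by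
    have : B ≤ (ENNReal.ofReal s)⁻¹ * ∫⁻ t in Set.Ioo (0:ℝ) 1, rearr f t := by
      calc B ≤ ∫⁻ t in Set.Ioo s 1, (ENNReal.ofReal s)⁻¹ * rearr f t := by
            refine setLIntegral_mono' measurableSet_Ioo fun t ht => ?_
            gcongr
            exact ht.1.le
        _ = (ENNReal.ofReal s)⁻¹ * ∫⁻ t in Set.Ioo s 1, rearr f t := lintegral_const_mul _ hF
        _ ≤ _ := by
            gcongr
            exact hs.1.le
    exact ne_top_of_le_ne_top (ENNReal.mul_ne_top (einv_ne_top hs.1) hfin) this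
  have eq1 : (∫⁻ t in Set.Ioo s 1, (ENNReal.ofReal t)⁻¹ * (dstar f t - rearr f t)) + B =
      ∫⁻ t in Set.Ioo s 1, (ENNReal.ofReal t)⁻¹ * dstar f t := by
    rw [hB, ← lintegral_add_right _ hmF]
    refine setLIntegral_congr_fun measurableSet_Ioo fun t ht => ?_
    try simp only
    rw [← mul_add, tsub_add_cancel_of_le (rearr_le_dstar f (hs.1.trans ht.1))]
  have eq2 : ∫⁻ t in Set.Ioo s 1, (ENNReal.ofReal t)⁻¹ * dstar f t =
      (∫⁻ t in Set.Ioo s 1, qw t) * A +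
        ∫⁻ t in Set.Ioo s 1, rearr f t * ∫⁻ r in Set.Ioo t 1, qw r := by
    rw [tonelli_triangle hF qw_measurable, ← lintegral_mul_const _ qw_measurable,
      ← lintegral_add_left (qw_measurable.mul_const _)]
    refine setLIntegral_congr_fun measurableSet_Ioo fun t ht => ?_
    try simp only
    rw [← mul_add, hA, ← lintegral_split _ hs.1 ht.1]
    simp only [qw, dstar, mul_assoc]
  have eq3 : (∫⁻ t in Set.Ioo s 1, rearr f t * ∫⁻ r in Set.Ioo t 1, qw r) +
      ∫⁻ t in Set.Ioo s 1, rearr f t = B := by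
    rw [hB, ← lintegral_add_right _ hF]
    refine setLIntegral_congr_fun measurableSet_Ioo fun t ht => ?_
    try simp only
    rw [← lintegral_qw (hs.1.trans ht.1) ht.2.le]
    simp
    ring
  have eq4 := lintegral_qw hs.1 hs.2.le
  rw [← ENNReal.add_le_add_iff_right hBfin]
  have eq5 := lintegral_split (rearr f) hs.1 hs.2
  apply le_of_eq
  rw [add_right_comm, eq1, eq2, eq5, dstar, ← eq4]
  nth_rewrite 1 [← eq3]
  simp
  ring

section lemmaU

variable {ψ : ℝ → ℝ≥0∞} {P N : ℝ≥0∞}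

/-- `k = P + ∫_t^1 ψ/s² - ψ/t`. -/
def kfun (ψ : ℝ → ℝ≥0∞) (P : ℝ≥0∞) (t : ℝ) : ℝ≥0∞ :=
  P + (∫⁻ r in Set.Ioo t 1, qw r * ψ r) - (ENNReal.ofReal t)⁻¹ * ψ t

lemma kfun_measurable (hψ : Monotone ψ) : Measurable (kfun ψ P) :=
  ((tail_anti _).measurable.const_add P).sub (einv_measurable.mul hψ.measurable)

lemma psi_div_le (hψ : Monotone ψ) {t t' : ℝ} (ht : 0 < t) (htt : t ≤ t') :
    (ENNReal.ofReal t)⁻¹ * ψ t ≤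
      (∫⁻ r in Set.Ioo t t', qw r * ψ r) + (ENNReal.ofReal t')⁻¹ * ψ t' := by
  rw [← lintegral_qw ht htt, add_mul]
  gcongr
  · rw [← lintegral_mul_const _ qw_measurable]
    refine setLIntegral_mono' measurableSet_Ioo fun s hs => ?_
    gcongr
    exact hψ hs.1.le
  · exact hψ htt

lemma kfun_add (hψ : Monotone ψ) (hP : ∀ t < 1, ψ t ≤ P) {t : ℝ} (ht : t ∈ Set.Ioo (0:ℝ) 1) :
    kfun ψ P t + (ENNReal.ofReal t)⁻¹ * ψ t = P + ∫⁻ r in Set.Ioo t 1, qw r * ψ r := by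
  unfold kfun
  apply tsub_add_cancel_of_le
  rw [← lintegral_qw ht.1 ht.2.le, add_mul, add_comm]
  gcongr
  · simpa using hP t ht.2
  · rw [← lintegral_mul_const _ qw_measurable]
    refine setLIntegral_mono' measurableSet_Ioo fun s hs => ?_
    gcongr
    exact hψ hs.1.le

lemma psi_div_le_N (hN : ∀ t, ψ t ≤ N * ENNReal.ofReal t) {t : ℝ} (ht : 0 < t) :
    (ENNReal.ofReal t)⁻¹ * ψ t ≤ N := by
  calc (ENNReal.ofReal t)⁻¹ * ψ t ≤ (ENNReal.ofReal t)⁻¹ * (N * ENNReal.ofReal t) := by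
        gcongr; exact hN t
    _ = N := by rw [mul_comm N, ← mul_assoc, einv_mul ht, one_mul]

lemma kfun_antitoneOn (hψ : Monotone ψ) (hP : ∀ t < 1, ψ t ≤ P) (hNt : N ≠ ⊤)
    (hN : ∀ t, ψ t ≤ N * ENNReal.ofReal t) : AntitoneOn (kfun ψ P) (Set.Ioo 0 1) := by
  intro t ht t' ht' htt
  rcases htt.eq_or_lt with rfl | hlt
  · exact le_rfl
  have hx : (ENNReal.ofReal t)⁻¹ * ψ t ≠ ⊤ :=
    ne_top_of_le_ne_top hNt (psi_div_le_N hN ht.1)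
  rw [← ENNReal.add_le_add_iff_right hx, kfun_add hψ hP ht, lintegral_split _ hlt ht'.2]
  calc kfun ψ P t' + (ENNReal.ofReal t)⁻¹ * ψ t
      ≤ kfun ψ P t' + ((∫⁻ r in Set.Ioo t t', qw r * ψ r) + (ENNReal.ofReal t')⁻¹ * ψ t') := by
        gcongr
        exact psi_div_le hψ ht.1 htt
    _ = (kfun ψ P t' + (ENNReal.ofReal t')⁻¹ * ψ t') + ∫⁻ r in Set.Ioo t t', qw r * ψ r := by ring
    _ = _ := by rw [kfun_add hψ hP ht']; ring

lemma lintegral_kfun_le (hψ : Monotone ψ) (hP : ∀ t < 1, ψ t ≤ P) (hNt : N ≠ ⊤)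
    (hN : ∀ t, ψ t ≤ N * ENNReal.ofReal t) {t : ℝ} (ht : t ∈ Set.Ioo (0:ℝ) 1) :
    ∫⁻ s in Set.Ioo (0:ℝ) t, kfun ψ P s ≤
      ENNReal.ofReal t * (P + ∫⁻ r in Set.Ioo t 1, qw r * ψ r) := by
  set X := ∫⁻ s in Set.Ioo (0:ℝ) t, (ENNReal.ofReal s)⁻¹ * ψ s with hX
  have hm : Measurable fun s : ℝ => (ENNReal.ofReal s)⁻¹ * ψ s := einv_measurable.mul hψ.measurable
  have hXfin : X ≠ ⊤ := by
    have : X ≤ ∫⁻ s in Set.Ioo (0:ℝ) t, N :=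
      setLIntegral_mono' measurableSet_Ioo fun s hs => psi_div_le_N hN hs.1
    refine ne_top_of_le_ne_top ?_ this
    simp [ENNReal.mul_eq_top, hNt]
  rw [← ENNReal.add_le_add_iff_right hXfin, hX, ← lintegral_add_right _ hm]
  apply le_of_eq
  have hqm : Measurable fun r => qw r * ψ r := qw_measurable.mul hψ.measurable
  have e1 : ∫⁻ s in Set.Ioo (0:ℝ) t, (kfun ψ P s + (ENNReal.ofReal s)⁻¹ * ψ s) =
      ∫⁻ s in Set.Ioo (0:ℝ) t, ((P + ∫⁻ r in Set.Ioo t 1, qw r * ψ r) +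
        1 * ∫⁻ r in Set.Ioo s t, qw r * ψ r) := by
    refine setLIntegral_congr_fun measurableSet_Ioo fun s hs => ?_
    try simp only
    rw [kfun_add hψ hP ⟨hs.1, hs.2.trans ht.2⟩, lintegral_split _ hs.2 ht.2]
    ring
  rw [e1, lintegral_add_left measurable_const, tonelli_triangle measurable_const hqm]
  congr 1
  · simp [mul_comm]
  · refine setLIntegral_congr_fun measurableSet_Ioo fun s hs => ?_
    have := einv_mul hs.1
    simp only [qw, lintegral_const, one_mul, MeasurableSet.univ, Measure.restrict_apply, univ_inter,
      Real.volume_Ioo, sub_zero]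
    calc _ = ((ENNReal.ofReal s)⁻¹ * ENNReal.ofReal s) * ((ENNReal.ofReal s)⁻¹ * ψ s) := by ring
      _ = _ := by rw [this, one_mul]

lemma lintegral_mul_psi_le (hψ : Monotone ψ) (hP : ∀ t < 1, ψ t ≤ P) (hNt : N ≠ ⊤)
    (hN : ∀ t, ψ t ≤ N * ENNReal.ofReal t) {f : ℝ → ℝ≥0∞}
    (hfin : ∫⁻ t in Set.Ioo (0:ℝ) 1, rearr f t ≠ ⊤) :
    ∫⁻ t in Set.Ioo (0:ℝ) 1, (ENNReal.ofReal t)⁻¹ * ψ t * (dstar f t - rearr f t) ≤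
      ∫⁻ t in Set.Ioo (0:ℝ) 1, rearr f t * kfun ψ P t := by
  have hF := rearr_measurable f
  have hm : Measurable fun s : ℝ => (ENNReal.ofReal s)⁻¹ * ψ s := einv_measurable.mul hψ.measurable
  have hqm : Measurable fun r => qw r * ψ r := qw_measurable.mul hψ.measurable
  set X := ∫⁻ t in Set.Ioo (0:ℝ) 1, (ENNReal.ofReal t)⁻¹ * ψ t * rearr f t with hX
  have hXfin : X ≠ ⊤ := by
    have : X ≤ ∫⁻ s in Set.Ioo (0:ℝ) 1, N * rearr f s := by
      refine setLIntegral_mono' measurableSet_Ioo fun s hs => ?_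
      gcongr
      exact psi_div_le_N hN hs.1
    rw [lintegral_const_mul _ hF] at this
    exact ne_top_of_le_ne_top (ENNReal.mul_ne_top hNt hfin) this
  have hmF : Measurable fun t : ℝ => (ENNReal.ofReal t)⁻¹ * ψ t * rearr f t := hm.mul hF
  rw [← ENNReal.add_le_add_iff_right hXfin, hX, ← lintegral_add_right _ hmF,
    ← lintegral_add_right _ hmF]
  calc ∫⁻ t in Set.Ioo (0:ℝ) 1, ((ENNReal.ofReal t)⁻¹ * ψ t * (dstar f t - rearr f t) +
        (ENNReal.ofReal t)⁻¹ * ψ t * rearr f t)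
      = ∫⁻ t in Set.Ioo (0:ℝ) 1, qw t * ψ t * ∫⁻ s in Set.Ioo (0:ℝ) t, rearr f s := by
        refine setLIntegral_congr_fun measurableSet_Ioo fun t ht => ?_
        try simp only
        rw [← mul_add, tsub_add_cancel_of_le (rearr_le_dstar f ht.1), dstar, qw]
        ring
    _ = ∫⁻ s in Set.Ioo (0:ℝ) 1, rearr f s * ∫⁻ r in Set.Ioo s 1, qw r * ψ r :=
        (tonelli_triangle hF hqm 0 1).symm
    _ ≤ _ := by
        refine setLIntegral_mono' measurableSet_Ioo fun t ht => ?_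
        have := kfun_add hψ hP ht
        calc rearr f t * ∫⁻ r in Set.Ioo t 1, qw r * ψ r
            ≤ rearr f t * (P + ∫⁻ r in Set.Ioo t 1, qw r * ψ r) := by
              gcongr
              exact le_add_self
          _ = _ := by rw [← this]; ring

end lemmaU
/-- Dyadic pieces of `(0,1)`. -/
def dya (j : ℕ) : Set ℝ := {t | (1/2 : ℝ) ^ (j+1) < t ∧ t ≤ (1/2 : ℝ) ^ j ∧ t < 1}

lemma dya_measurable (j : ℕ) : MeasurableSet (dya j) := by
  have : dya j = Set.Ioc ((1/2 : ℝ) ^ (j+1)) ((1/2 : ℝ) ^ j) ∩ Set.Iio 1 := by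
    ext t; simp [dya, and_assoc]
  rw [this]
  exact measurableSet_Ioc.inter measurableSet_Iio

lemma dya_index_le {i j : ℕ} {r t : ℝ} (hr : r ≤ (1/2 : ℝ) ^ i) (ht : (1/2 : ℝ) ^ (j+1) < t)
    (htr : t ≤ r) : i ≤ j := by
  have h : (1/2 : ℝ) ^ (j+1) < (1/2 : ℝ) ^ i := by linarith
  rw [pow_lt_pow_iff_right_of_lt_one₀ (by norm_num) (by norm_num)] at h
  omega

lemma dya_uniq {i j : ℕ} {x : ℝ} (hi : x ∈ dya i) (hj : x ∈ dya j) : i = j :=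
  le_antisymm (dya_index_le hi.2.1 hj.1 le_rfl) (dya_index_le hj.2.1 hi.1 le_rfl)

lemma dya_exists {x : ℝ} (hx : x ∈ Set.Ioo (0:ℝ) 1) : ∃ i, x ∈ dya i := by
  obtain ⟨n, h1, h2⟩ := exists_nat_pow_near_of_lt_one hx.1 hx.2.le
    (by norm_num : (0:ℝ) < 1/2) (by norm_num)
  exact ⟨n, h1, h2, hx.2⟩

lemma dya_sub (j : ℕ) : dya j ⊆ Set.Ioo (0:ℝ) 1 := by
  intro x hx
  exact ⟨lt_trans (by positivity) hx.1, hx.2.2⟩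

lemma map_affine (b : ℝ) : Measure.map (fun x : ℝ => 4 * (x - b)) volume =
    ENNReal.ofReal (1/4) • (volume : Measure ℝ) := by
  have h1 : (fun x : ℝ => 4 * (x - b)) = (fun x => 4 * x) ∘ (fun x => x - b) := rfl
  rw [h1, ← Measure.map_map (by fun_prop) (by fun_prop),
    (measurePreserving_sub_right volume b).map_eq, Real.map_volume_mul_left (by norm_num)]
  congr 2
  rw [abs_of_pos] <;> norm_num

lemma transplant {ρ : (ℝ → ℝ≥0∞) → ℝ≥0∞} (hρ : IsRiNorm ρ) {u : ℝ → ℝ≥0∞}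
    (hu : ∀ a x : ℝ, 0 < a → a ≤ x → x ≤ 2 * a → x < 1 → u x ≤ 2 * u a ∧ u a ≤ 2 * u x) :
    assoc ρ (fun t => ⨆ r ∈ Set.Ico t 1, u r) ≤ 16 * assoc ρ u := by
  obtain ⟨-, -, -, hmono, -, -, -, hri⟩ := hρ
  conv_lhs => unfold assoc
  refine iSup₂_le fun v hv => ?_
  obtain ⟨hvm, hv1⟩ := hv
  have hex : ∀ j : ℕ, ∃ i ≤ j, ∀ i' ≤ j, u ((1/2 : ℝ) ^ (i'+1)) ≤ u ((1/2 : ℝ) ^ (i+1)) := by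
    intro j
    obtain ⟨i, hi, him⟩ := Finset.exists_max_image (Finset.range (j+1))
      (fun i => u ((1/2 : ℝ) ^ (i+1))) ⟨0, by simp⟩
    refine ⟨i, by simpa [Nat.lt_succ_iff] using hi, fun i' hi' => ?_⟩
    exact him i' (by simpa [Nat.lt_succ_iff] using hi')
  choose ix hix hmax using hex
  set b : ℕ → ℝ := fun j => (1/2 : ℝ) ^ (ix j + 1) with hb
  set τ : ℕ → ℝ → ℝ := fun j x => 4 * (x - b j) with hτ
  have hτm : ∀ j, Measurable (τ j) := fun j => by simp only [hτ]; fun_prop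
  set E : ℕ → Set ℝ := fun j => τ j ⁻¹' dya j with hE
  have hEm : ∀ j, MeasurableSet (E j) := fun j => hτm j (dya_measurable j)
  have hb0 : ∀ j, 0 < b j := fun j => by simp only [hb]; positivity
  have hEs : ∀ j x, x ∈ E j → b j < x ∧ x ≤ 2 * b j ∧ x < 1 := by
    intro j x hx
    have h1 : (1/2 : ℝ) ^ (j+1) < 4 * (x - b j) := hx.1
    have h2 : 4 * (x - b j) ≤ (1/2 : ℝ) ^ j := hx.2.1
    have h3 : (1/2 : ℝ) ^ (j+1) ≤ b j := 
      pow_le_pow_of_le_one (by norm_num) (by norm_num) (by have := hix j; omega)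
    have h4 : (0 : ℝ) < (1/2 : ℝ) ^ (j+1) := by positivity
    have h5 : (1/2 : ℝ) ^ j = 2 * (1/2 : ℝ) ^ (j+1) := by rw [pow_succ]; ring
    have h6 : b j ≤ 1/2 := by
      simp only [hb]
      calc (1/2 : ℝ) ^ (ix j + 1) ≤ (1/2 : ℝ) ^ 1 :=
            pow_le_pow_of_le_one (by norm_num) (by norm_num) (by omega)
        _ = 1/2 := by norm_num
    refine ⟨by linarith, by linarith, by linarith⟩
  have hEd : ∀ j x, x ∈ E j → x ∈ dya (ix j) := by
    intro j x hx
    obtain ⟨h1, h2, h3⟩ := hEs j x hx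
    refine ⟨h1, ?_, h3⟩
    have h5 : (1/2 : ℝ) ^ (ix j) = 2 * (1/2 : ℝ) ^ (ix j+1) := by rw [pow_succ]; ring
    rw [h5]; exact h2
  have hdisj : Pairwise (Function.onFun Disjoint E) := by
    intro j j' hjj
    rw [Function.onFun, Set.disjoint_left]
    intro x hx hx'
    have hii := dya_uniq (hEd j x hx) (hEd j' x hx')
    apply hjj
    have hbb : b j = b j' := by simp only [hb, hii]
    have hx2 : 4 * (x - b j') ∈ dya j' := hx'
    rw [← hbb] at hx2
    exact dya_uniq hx hx2
  set V : ℝ → ℝ≥0∞ := fun x => ⨆ j, (E j).indicator (fun x => v (τ j x)) x with hV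
  have hVm : Measurable V := by
    apply Measurable.iSup
    intro j
    exact (hvm.comp (hτm j)).indicator (hEm j)
  have hVE : ∀ j x, x ∈ E j → v (τ j x) ≤ V x := by
    intro j x hx
    have := le_iSup (fun j => (E j).indicator (fun x => v (τ j x)) x) j
    simpa [indicator_of_mem hx] using this
  have hrear : ∀ t, rearr V t ≤ rearr v t := by
    intro t
    rw [rearr_le_iff]
    refine le_trans ?_ ((rearr_le_iff v t (rearr v t)).1 le_rfl)
    set l := rearr v t
    have hlm : MeasurableSet {x | l < v x} := measurableSet_lt measurable_const hvm
    calc volume {x ∈ Set.Ioo (0:ℝ) 1 | l < V x}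
        ≤ volume (⋃ j, τ j ⁻¹' (dya j ∩ {x | l < v x})) := by
          apply measure_mono
          rintro x ⟨-, hx⟩
          obtain ⟨j, hj⟩ := lt_iSup_iff.1 hx
          rw [mem_iUnion]
          refine ⟨j, ?_⟩
          by_cases hxE : x ∈ E j
          · rw [indicator_of_mem hxE] at hj
            exact ⟨hxE, hj⟩
          · rw [indicator_of_notMem hxE] at hj
            simp at hj
      _ ≤ ∑' j, volume (τ j ⁻¹' (dya j ∩ {x | l < v x})) := measure_iUnion_le _
      _ ≤ ∑' j, volume (dya j ∩ {x | l < v x}) := by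
          apply ENNReal.tsum_le_tsum
          intro j
          rw [← Measure.map_apply (hτm j) ((dya_measurable j).inter hlm), map_affine,
            Measure.smul_apply, smul_eq_mul]
          calc _ ≤ 1 * volume (dya j ∩ {x | l < v x}) := by
                gcongr
                rw [ENNReal.ofReal_le_one]; norm_num
            _ = _ := one_mul _
      _ = volume (⋃ j, dya j ∩ {x | l < v x}) := by
          rw [measure_iUnion]
          · intro j j' hjj
            rw [Function.onFun, Set.disjoint_left]
            intro x hx hx'
            exact hjj (dya_uniq hx.1 hx'.1)
          · intro j
            exact (dya_measurable j).inter hlm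
      _ ≤ volume {s ∈ Set.Ioo (0:ℝ) 1 | l < v s} := by
          apply measure_mono
          intro x hx
          obtain ⟨j, hj⟩ := mem_iUnion.1 hx
          exact ⟨dya_sub j hj.1, hj.2⟩
  have hV1 : ρ V ≤ 1 := by
    rw [hri V hVm]
    refine le_trans (hmono _ _ (rearr_measurable _) (rearr_measurable _)
      (Eventually.of_forall hrear)) ?_
    rw [← hri v hvm]; exact hv1
  set w : ℝ → ℝ≥0∞ := fun t => ⨆ r ∈ Set.Ico t 1, u r with hw
  have hwle : ∀ j t, t ∈ dya j → w t ≤ 2 * u (b j) := by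
    intro j t ht
    refine iSup₂_le fun r hr => ?_
    have hr0 : 0 < r := (dya_sub j ht).1.trans_le hr.1
    obtain ⟨i, hi⟩ := dya_exists ⟨hr0, hr.2⟩
    have hij := dya_index_le hi.2.1 ht.1 hr.1
    have h5 : (1/2 : ℝ) ^ i = 2 * (1/2 : ℝ) ^ (i+1) := by rw [pow_succ]; ring
    have h6 := (hu ((1/2 : ℝ) ^ (i+1)) r (by positivity) hi.1.le (by rw [← h5]; exact hi.2.1) hr.2).1
    refine h6.trans ?_
    gcongr
    exact hmax j i hij
  have hpiece : ∀ j, ∫⁻ t in dya j, w t * v t ≤ 16 * ∫⁻ x in E j, u x * V x := by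
    intro j
    have hcv : ∫⁻ x in E j, v (τ j x) = ENNReal.ofReal (1/4) * ∫⁻ t in dya j, v t := by
      rw [hE, ← setLIntegral_map (dya_measurable j) hvm (hτm j), map_affine,
        Measure.restrict_smul, lintegral_smul_measure, smul_eq_mul]
    have h4 : ∫⁻ t in dya j, v t = 4 * ∫⁻ x in E j, v (τ j x) := by
      rw [hcv, ← mul_assoc]
      have : (4 : ℝ≥0∞) * ENNReal.ofReal (1/4) = 1 := by
        rw [show (4 : ℝ≥0∞) = ENNReal.ofReal 4 by simp, ← ENNReal.ofReal_mul (by norm_num)]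
        norm_num
      rw [this, one_mul]
    calc ∫⁻ t in dya j, w t * v t ≤ ∫⁻ t in dya j, 2 * u (b j) * v t := by
          refine setLIntegral_mono' (dya_measurable j) fun t ht => ?_
          gcongr
          exact hwle j t ht
      _ = 2 * u (b j) * (4 * ∫⁻ x in E j, v (τ j x)) := by
          rw [lintegral_const_mul _ hvm, h4]
      _ = 8 * ∫⁻ x in E j, u (b j) * v (τ j x) := by
          have hvt : Measurable (fun x => v (τ j x)) := hvm.comp (hτm j)
          rw [lintegral_const_mul _ hvt]
          ring
      _ ≤ 8 * ∫⁻ x in E j, 2 * (u x * V x) := by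
          refine mul_le_mul_right ?_ _
          refine setLIntegral_mono' (hEm j) fun x hx => ?_
          rw [← mul_assoc]
          obtain ⟨h1, h2, h3⟩ := hEs j x hx
          exact mul_le_mul' (hu (b j) x (hb0 j) h1.le h2 h3).2 (hVE j x hx)
      _ = 16 * ∫⁻ x in E j, u x * V x := by
          rw [lintegral_const_mul' _ _ (by simp), ← mul_assoc]
          norm_num
  calc ∫⁻ t in Set.Ioo (0:ℝ) 1, w t * v t
      ≤ ∫⁻ t in ⋃ j, dya j, w t * v t := by
        apply lintegral_mono_set
        intro x hx
        exact mem_iUnion.2 (dya_exists hx)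
    _ ≤ ∑' j, ∫⁻ t in dya j, w t * v t := lintegral_iUnion_le _ _
    _ ≤ ∑' j, 16 * ∫⁻ x in E j, u x * V x := ENNReal.tsum_le_tsum hpiece
    _ = 16 * ∑' j, ∫⁻ x in E j, u x * V x := ENNReal.tsum_mul_left
    _ = 16 * ∫⁻ x in ⋃ j, E j, u x * V x := by rw [lintegral_iUnion hEm hdisj]
    _ ≤ 16 * ∫⁻ x in Set.Ioo (0:ℝ) 1, u x * V x := by
        refine mul_le_mul_right (lintegral_mono_set ?_) _
        intro x hx
        obtain ⟨j, hj⟩ := mem_iUnion.1 hx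
        exact dya_sub _ (hEd j x hj)
    _ ≤ 16 * assoc ρ u := by
        refine mul_le_mul_right ?_ _
        exact le_iSup₂ (f := fun (g : ℝ → ℝ≥0∞) (_ : Measurable g ∧ ρ g ≤ 1) =>
          ∫⁻ t in Set.Ioo (0:ℝ) 1, u t * g t) V ⟨hVm, hV1⟩
section final

variable {I : ℝ → ℝ}

lemma I_pos (hqc : Quasiconcave I) {t : ℝ} (ht : t ∈ Set.Ioo (0:ℝ) 1) : 0 < I t :=
  (hqc.1.mapsTo ht).1

lemma I_lt_one (hqc : Quasiconcave I) {t : ℝ} (ht : t ∈ Set.Ioo (0:ℝ) 1) : I t < 1 :=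
  (hqc.1.mapsTo ht).2

lemma J_ne_zero (hqc : Quasiconcave I) {t : ℝ} (ht : t ∈ Set.Ioo (0:ℝ) 1) :
    ENNReal.ofReal (I t) ≠ 0 := by
  simp [I_pos hqc ht]

lemma J_inv_mul (hqc : Quasiconcave I) {t : ℝ} (ht : t ∈ Set.Ioo (0:ℝ) 1) :
    (ENNReal.ofReal (I t))⁻¹ * ENNReal.ofReal (I t) = 1 :=
  ENNReal.inv_mul_cancel (J_ne_zero hqc ht) ENNReal.ofReal_ne_top

lemma J_mono (hqc : Quasiconcave I) {s t : ℝ} (hs : 0 < s) (hst : s ≤ t) (ht : t < 1) :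
    ENNReal.ofReal (I s) ≤ ENNReal.ofReal (I t) :=
  ENNReal.ofReal_le_ofReal (hqc.2.1 ⟨hs, hst.trans_lt ht⟩ ⟨hs.trans_le hst, ht⟩ hst)

lemma I_quasi (hqc : Quasiconcave I) {s t : ℝ} (hs : 0 < s) (hst : s ≤ t) (ht : t < 1) :
    I t * s ≤ I s * t := by
  have h := hqc.2.2.1 (show s ∈ Set.Ioo (0:ℝ) 1 from ⟨hs, hst.trans_lt ht⟩)
    (show t ∈ Set.Ioo (0:ℝ) 1 from ⟨hs.trans_le hst, ht⟩) hst
  simp only at h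
  rwa [div_le_div_iff₀ (hs.trans_le hst) hs] at h

lemma J_quasi (hqc : Quasiconcave I) {s t : ℝ} (hs : 0 < s) (hst : s ≤ t) (ht : t < 1) :
    ENNReal.ofReal (I t) * ENNReal.ofReal s ≤ ENNReal.ofReal (I s) * ENNReal.ofReal t := by
  rw [← ENNReal.ofReal_mul (I_pos hqc ⟨hs.trans_le hst, ht⟩).le,
    ← ENNReal.ofReal_mul (I_pos hqc ⟨hs, hst.trans_lt ht⟩).le]
  exact ENNReal.ofReal_le_ofReal (I_quasi hqc hs hst ht)

lemma J_lower (hqc : Quasiconcave I) {t : ℝ} (ht : t ∈ Set.Ioo (0:ℝ) 1) :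
    ENNReal.ofReal t ≤ 2 * ENNReal.ofReal (I t) := by
  obtain ⟨s, hs, hs2⟩ := hqc.1.surjOn (show (1/2 : ℝ) ∈ Set.Ioo (0:ℝ) 1 by constructor <;> norm_num)
  rw [show (2 : ℝ≥0∞) = ENNReal.ofReal 2 by simp, ← ENNReal.ofReal_mul (by norm_num)]
  apply ENNReal.ofReal_le_ofReal
  rcases le_total t s with h | h
  · have := I_quasi hqc ht.1 h hs.2
    rw [hs2] at this
    have h3 := I_pos hqc ht
    nlinarith [hs.2, hs.1]
  · have := hqc.2.1 hs ht h
    rw [hs2] at this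
    linarith [ht.2]

lemma le_optTarget {ρ : (ℝ → ℝ≥0∞) → ℝ≥0∞} {f k : ℝ → ℝ≥0∞} (hkm : Measurable k)
    (hk : AntitoneOn k (Set.Ioo 0 1)) (h : assoc ρ (RI I k) ≤ 1) :
    ∫⁻ t in Set.Ioo (0:ℝ) 1, rearr f t * k t ≤ optTargetNorm I ρ f := by
  have e : ∫⁻ t in Set.Ioo (0:ℝ) 1, rearr f t * k t =
      ∫⁻ t in Set.Ioo (0:ℝ) 1, rearr f t * rearr k t := by
    apply lintegral_congr_ae
    filter_upwards [rearr_ae_eq_of_antitoneOn hk] with t ht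
    rw [ht]
  rw [e]
  unfold optTargetNorm
  refine le_iSup₂ (f := fun (g : ℝ → ℝ≥0∞) (_ : Measurable g ∧ assoc ρ (RI I (rearr g)) ≤ 1) =>
    ∫⁻ t in Set.Ioo (0:ℝ) 1, rearr f t * rearr g t) k ⟨hkm, le_trans (assoc_mono ?_) h⟩
  intro t ht
  unfold RI
  refine mul_le_mul_right ?_ _
  refine setLIntegral_mono' measurableSet_Ioo fun s hs => ?_
  exact rearr_le_of_antitoneOn hk ⟨hs.1, hs.2.trans ht.2⟩

lemma lOne_le (hqc : Quasiconcave I) {ρ : (ℝ → ℝ≥0∞) → ℝ≥0∞} (hρ : IsRiNorm ρ) :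
    ∃ c : ℝ, 0 < c ∧ ∀ f : ℝ → ℝ≥0∞, Measurable f →
      lOne f ≤ ENNReal.ofReal c * optTargetNorm I ρ f := by
  obtain ⟨-, -, -, -, -, -, ⟨c, hc, hcl⟩, -⟩ := hρ
  refine ⟨2 * c, by positivity, fun f hf => ?_⟩
  set a : ℝ≥0∞ := (ENNReal.ofReal (2 * c))⁻¹ with ha
  have hat : a ≠ ⊤ := einv_ne_top (by positivity)
  have h1 : ∫⁻ t in Set.Ioo (0:ℝ) 1, rearr f t * a ≤ optTargetNorm I ρ f := by
    apply le_optTarget measurable_const (fun _ _ _ _ _ => le_rfl)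
    calc assoc ρ (RI I fun _ => a) ≤ assoc ρ (fun _ => (2 * a) * 1) := by
          apply assoc_mono
          intro t ht
          unfold RI
          simp only [lintegral_const, MeasurableSet.univ, Measure.restrict_apply, univ_inter,
            Real.volume_Ioo, sub_zero, mul_one]
          calc (ENNReal.ofReal (I t))⁻¹ * (a * ENNReal.ofReal t)
              ≤ (ENNReal.ofReal (I t))⁻¹ * (a * (2 * ENNReal.ofReal (I t))) := by
                gcongr; exact J_lower hqc ht
            _ = ((ENNReal.ofReal (I t))⁻¹ * ENNReal.ofReal (I t)) * (2 * a) := by ring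
            _ = _ := by rw [J_inv_mul hqc ht, one_mul]
      _ ≤ (2 * a) * assoc ρ (fun _ => 1) :=
          assoc_const_mul_le (ENNReal.mul_ne_top (by simp) hat)
      _ ≤ (2 * a) * ENNReal.ofReal c := by
          gcongr
          unfold assoc
          refine iSup₂_le fun v hv => ?_
          simp only [one_mul]
          calc _ ≤ _ := hcl v hv.1
            _ ≤ ENNReal.ofReal c * 1 := by gcongr; exact hv.2
            _ = _ := mul_one _
      _ = a * ENNReal.ofReal (2 * c) := by
          rw [ENNReal.ofReal_mul (by norm_num)]; simp; ring
      _ = 1 := einv_mul (by positivity)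
  rw [lintegral_mul_const _ (rearr_measurable f), lintegral_rearr f hf] at h1
  calc lOne f = ENNReal.ofReal (2*c) * (lOne f * a) := by
        rw [mul_comm (lOne f), ← mul_assoc, mul_comm _ a, einv_mul (by positivity), one_mul]
    _ ≤ _ := by gcongr

lemma I_div {t : ℝ} (ht : 0 < t) :
    ENNReal.ofReal (I t / t) = (ENNReal.ofReal t)⁻¹ * ENNReal.ofReal (I t) := by
  rw [ENNReal.ofReal_div_of_pos ht, ENNReal.div_eq_inv_mul]

lemma I_div_sq {t : ℝ} (ht : 0 < t) :
    ENNReal.ofReal (I t / t ^ 2) = qw t * ENNReal.ofReal (I t) := by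
  rw [ENNReal.ofReal_div_of_pos (by positivity), ENNReal.div_eq_inv_mul, pow_two,
    ENNReal.ofReal_mul ht.le, ENNReal.mul_inv, qw]
  · simp [ht]
  · simp

lemma upper_bound (hqc : Quasiconcave I) (hstar : StarCond I) (hmax : MaxCond I)
    (ρ : (ℝ → ℝ≥0∞) → ℝ≥0∞) :
    ∃ c : ℝ, 0 < c ∧ ∀ f g : ℝ → ℝ≥0∞, ∫⁻ t in Set.Ioo (0:ℝ) 1, rearr f t ≠ ⊤ →
      assoc ρ (SI I g) ≤ 1 →
      ∫⁻ t in Set.Ioo (0:ℝ) 1, ENNReal.ofReal (I t / t) * (dstar f t - rearr f t) * rearr g t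
        ≤ ENNReal.ofReal c * optTargetNorm I ρ f := by
  obtain ⟨Cs, hCs, hstar⟩ := hstar
  obtain ⟨C, hC, hmax⟩ := hmax
  refine ⟨1 + C * Cs, by positivity, fun f g hfin hg => ?_⟩
  set φ : ℝ → ℝ≥0∞ := fun t => ⨆ s ∈ Set.Ioc (0:ℝ) t, ENNReal.ofReal (I s) * rearr g s with hφ
  have hφm : Monotone φ := by
    intro s t hst
    exact biSup_mono fun r hr => ⟨hr.1, hr.2.trans hst⟩
  have hφge : ∀ t, 0 < t → ENNReal.ofReal (I t) * rearr g t ≤ φ t := fun t ht =>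
    le_iSup₂ (f := fun s (_ : s ∈ Set.Ioc (0:ℝ) t) => ENNReal.ofReal (I s) * rearr g s) t ⟨ht, le_rfl⟩
  have quasi1 : ∀ t s, 0 < t → t ≤ s → s < 1 →
      φ s * ENNReal.ofReal (I t) ≤ φ t * ENNReal.ofReal (I s) := by
    intro t s ht hts hs
    simp only [hφ]
    rw [ENNReal.iSup_mul]
    refine iSup_le fun r => ?_
    rw [ENNReal.iSup_mul]
    refine iSup_le fun hr => ?_
    rcases le_total r t with h | h
    · exact mul_le_mul' (le_iSup₂ (f := fun s (_ : s ∈ Set.Ioc (0:ℝ) t) =>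
        ENNReal.ofReal (I s) * rearr g s) r ⟨hr.1, h⟩) (J_mono hqc ht hts hs)
    · calc ENNReal.ofReal (I r) * rearr g r * ENNReal.ofReal (I t)
          ≤ ENNReal.ofReal (I s) * rearr g t * ENNReal.ofReal (I t) := by
            refine mul_le_mul' (mul_le_mul' (J_mono hqc hr.1 hr.2 hs) (rearr_antitone g h)) le_rfl
        _ = (ENNReal.ofReal (I t) * rearr g t) * ENNReal.ofReal (I s) := by ring
        _ ≤ _ := mul_le_mul' (hφge t ht) le_rfl
  have quasi1' : ∀ t s, 0 < t → t ≤ s → s < 1 →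
      φ s ≤ (φ t * (ENNReal.ofReal (I t))⁻¹) * ENNReal.ofReal (I s) := by
    intro t s ht hts hs
    have h := mul_le_mul_right (quasi1 t s ht hts hs) (ENNReal.ofReal (I t))⁻¹
    calc φ s = (ENNReal.ofReal (I t))⁻¹ * (φ s * ENNReal.ofReal (I t)) := by
          rw [mul_comm (φ s), ← mul_assoc, J_inv_mul hqc ⟨ht, hts.trans_lt hs⟩, one_mul]
      _ ≤ _ := h
      _ = _ := by ring
  have quasi2 : ∀ t s, 0 < t → t ≤ s → s < 1 →
      φ s * ENNReal.ofReal t ≤ φ t * ENNReal.ofReal s := by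
    intro t s ht hts hs
    calc φ s * ENNReal.ofReal t
        ≤ (φ t * (ENNReal.ofReal (I t))⁻¹) * ENNReal.ofReal (I s) * ENNReal.ofReal t := by
          gcongr; exact quasi1' t s ht hts hs
      _ = (φ t * (ENNReal.ofReal (I t))⁻¹) * (ENNReal.ofReal (I s) * ENNReal.ofReal t) := by ring
      _ ≤ (φ t * (ENNReal.ofReal (I t))⁻¹) * (ENNReal.ofReal (I t) * ENNReal.ofReal s) := by
          exact mul_le_mul_right (J_quasi hqc ht hts hs) _
      _ = φ t * ((ENNReal.ofReal (I t))⁻¹ * ENNReal.ofReal (I t)) * ENNReal.ofReal s := by ring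
      _ = _ := by rw [J_inv_mul hqc ⟨ht, hts.trans_lt hs⟩, mul_one]
  have hIae : AEMeasurable I (volume.restrict (Set.Ioo (0:ℝ) 1)) :=
    aemeasurable_restrict_of_monotoneOn measurableSet_Ioo hqc.2.1
  have tail : ∀ t ∈ Set.Ioo (0:ℝ) 1,
      ENNReal.ofReal t * ∫⁻ r in Set.Ioo t 1, qw r * φ r ≤ ENNReal.ofReal (C * Cs) * φ t := by
    intro t ht
    have hae : AEMeasurable (fun r => qw r * ENNReal.ofReal (I r))
        (volume.restrict (Set.Ioo t 1)) := by
      apply qw_measurable.aemeasurable.mul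
      apply AEMeasurable.ennreal_ofReal
      exact hIae.mono_set (Ioo_subset_Ioo ht.1.le le_rfl)
    have h1 : ∫⁻ r in Set.Ioo t 1, qw r * ENNReal.ofReal (I r) ≤
        ENNReal.ofReal (C / t) * ENNReal.ofReal (Cs * I t) := by
      calc ∫⁻ r in Set.Ioo t 1, qw r * ENNReal.ofReal (I r)
          = ∫⁻ r in Set.Ioo t 1, ENNReal.ofReal (I r / r ^ 2) := by
            refine setLIntegral_congr_fun measurableSet_Ioo fun r hr => ?_
            exact (I_div_sq (ht.1.trans hr.1)).symm
        _ ≤ _ := hmax t ht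
        _ ≤ _ := mul_le_mul_right (hstar t ht) _
    calc ENNReal.ofReal t * ∫⁻ r in Set.Ioo t 1, qw r * φ r
        ≤ ENNReal.ofReal t * ∫⁻ r in Set.Ioo t 1,
            (φ t * (ENNReal.ofReal (I t))⁻¹) * (qw r * ENNReal.ofReal (I r)) := by
          refine mul_le_mul_right ?_ _
          refine setLIntegral_mono' measurableSet_Ioo fun r hr => ?_
          calc qw r * φ r ≤ qw r * ((φ t * (ENNReal.ofReal (I t))⁻¹) * ENNReal.ofReal (I r)) :=
                mul_le_mul_right (quasi1' t r ht.1 hr.1.le hr.2) _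
            _ = _ := by ring
      _ = ENNReal.ofReal t * ((φ t * (ENNReal.ofReal (I t))⁻¹) *
            ∫⁻ r in Set.Ioo t 1, qw r * ENNReal.ofReal (I r)) := by
          rw [lintegral_const_mul'' _ hae]
      _ ≤ ENNReal.ofReal t * ((φ t * (ENNReal.ofReal (I t))⁻¹) *
            (ENNReal.ofReal (C / t) * ENNReal.ofReal (Cs * I t))) := by
          exact mul_le_mul_right (mul_le_mul_right h1 _) _
      _ = ENNReal.ofReal (C * Cs) * φ t := by
          rw [ENNReal.ofReal_mul hCs.le, ENNReal.ofReal_mul hC.le, div_eq_mul_inv,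
            ENNReal.ofReal_mul hC.le, ENNReal.ofReal_inv_of_pos ht.1]
          calc _ = ((ENNReal.ofReal t)⁻¹ * ENNReal.ofReal t) *
                ((ENNReal.ofReal (I t))⁻¹ * ENNReal.ofReal (I t)) *
                (ENNReal.ofReal C * ENNReal.ofReal Cs * φ t) := by ring
            _ = _ := by rw [einv_mul ht.1, J_inv_mul hqc ht, one_mul, one_mul]
  -- truncation
  set ψ : ℕ → ℝ → ℝ≥0∞ := fun n t => min (φ t) ((n : ℝ≥0∞) * ENNReal.ofReal t) with hψ
  have hψm : ∀ n, Monotone (ψ n) := by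
    intro n s t hst
    exact min_le_min (hφm hst) (mul_le_mul_right (ENNReal.ofReal_le_ofReal hst) _)
  have hψN : ∀ n t, ψ n t ≤ (n : ℝ≥0∞) * ENNReal.ofReal t := fun n t => min_le_right _ _
  have hψφ : ∀ n t, ψ n t ≤ φ t := fun n t => min_le_left _ _
  set D := ENNReal.ofReal (1 + C * Cs) with hD
  have hD0 : 0 < 1 + C * Cs := by positivity
  have hn : ∀ n, ∫⁻ t in Set.Ioo (0:ℝ) 1,
      (ENNReal.ofReal t)⁻¹ * ψ n t * (dstar f t - rearr f t) ≤ D * optTargetNorm I ρ f := by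
    intro n
    set P : ℝ≥0∞ := ⨆ t ∈ Set.Iio (1:ℝ), ψ n t with hP
    have hPle : ∀ t < 1, ψ n t ≤ P := fun t ht =>
      le_iSup₂ (f := fun t (_ : t ∈ Set.Iio (1:ℝ)) => ψ n t) t ht
    have hPφ : ∀ t ∈ Set.Ioo (0:ℝ) 1, ENNReal.ofReal t * P ≤ φ t := by
      intro t ht
      rw [hP, ENNReal.mul_iSup]
      refine iSup_le fun s => ?_
      rw [ENNReal.mul_iSup]
      refine iSup_le fun hs => ?_
      rcases le_total s t with h | h
      · calc ENNReal.ofReal t * ψ n s ≤ 1 * φ t := by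
              refine mul_le_mul' ?_ ((hψφ n s).trans (hφm h))
              rw [ENNReal.ofReal_le_one]; exact ht.2.le
          _ = φ t := one_mul _
      · calc ENNReal.ofReal t * ψ n s ≤ φ s * ENNReal.ofReal t := by
              rw [mul_comm]; exact mul_le_mul' (hψφ n s) le_rfl
          _ ≤ φ t * ENNReal.ofReal s := quasi2 t s ht.1 h hs
          _ ≤ φ t * 1 := by
              refine mul_le_mul_right ?_ _
              rw [ENNReal.ofReal_le_one]; exact (mem_Iio.1 hs).le
          _ = φ t := mul_one _
    have hNt : (n : ℝ≥0∞) ≠ ⊤ := ENNReal.natCast_ne_top n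
    have hanti := kfun_antitoneOn (hψm n) hPle hNt (hψN n)
    have hkm : Measurable (kfun (ψ n) P) := kfun_measurable (hψm n)
    refine (lintegral_mul_psi_le (hψm n) hPle hNt (hψN n) hfin).trans ?_
    have h1 : ∫⁻ t in Set.Ioo (0:ℝ) 1, rearr f t * (D⁻¹ * kfun (ψ n) P t) ≤
        optTargetNorm I ρ f := by
      apply le_optTarget (hkm.const_mul _)
      · intro s hs t ht hst
        exact mul_le_mul_right (hanti hs ht hst) _
      · refine le_trans (assoc_mono ?_) hg
        intro t ht
        unfold RI SI
        refine mul_le_mul_right ?_ _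
        rw [lintegral_const_mul _ hkm]
        calc D⁻¹ * ∫⁻ s in Set.Ioo (0:ℝ) t, kfun (ψ n) P s
            ≤ D⁻¹ * (ENNReal.ofReal t * (P + ∫⁻ r in Set.Ioo t 1, qw r * ψ n r)) :=
              mul_le_mul_right (lintegral_kfun_le (hψm n) hPle hNt (hψN n) ht) _
          _ ≤ D⁻¹ * (φ t + ENNReal.ofReal (C * Cs) * φ t) := by
              refine mul_le_mul_right ?_ _
              rw [mul_add]
              refine add_le_add (hPφ t ht) (le_trans (mul_le_mul_right ?_ _) (tail t ht))
              refine lintegral_mono fun r => mul_le_mul_right (hψφ n r) _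
          _ = D⁻¹ * D * φ t := by
              rw [hD, ENNReal.ofReal_add (by norm_num) (by positivity), ENNReal.ofReal_one]
              ring
          _ = φ t := by rw [einv_mul hD0, one_mul]
    calc ∫⁻ t in Set.Ioo (0:ℝ) 1, rearr f t * kfun (ψ n) P t
        = ∫⁻ t in Set.Ioo (0:ℝ) 1, D * (rearr f t * (D⁻¹ * kfun (ψ n) P t)) := by
          congr 1; ext t
          calc _ = (D⁻¹ * D) * (rearr f t * kfun (ψ n) P t) := by rw [einv_mul hD0, one_mul]
            _ = _ := by ring
      _ = D * ∫⁻ t in Set.Ioo (0:ℝ) 1, (rearr f t * (D⁻¹ * kfun (ψ n) P t)) :=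
          lintegral_const_mul _ ((rearr_measurable f).mul (hkm.const_mul _))
      _ ≤ _ := mul_le_mul_right h1 _
  have hsup : ∀ t : ℝ, 0 < t → ⨆ n, ψ n t = φ t := by
    intro t ht
    simp only [hψ]
    rw [← inf_iSup_eq, ← ENNReal.iSup_mul, ENNReal.iSup_natCast, ENNReal.top_mul (by simp [ht])]
    simp
  calc ∫⁻ t in Set.Ioo (0:ℝ) 1, ENNReal.ofReal (I t / t) * (dstar f t - rearr f t) * rearr g t
      ≤ ∫⁻ t in Set.Ioo (0:ℝ) 1, ⨆ n, (ENNReal.ofReal t)⁻¹ * ψ n t * (dstar f t - rearr f t) := by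
        refine setLIntegral_mono' measurableSet_Ioo fun t ht => ?_
        rw [← ENNReal.iSup_mul, ← ENNReal.mul_iSup, hsup t ht.1, I_div ht.1]
        calc _ = (ENNReal.ofReal t)⁻¹ * (ENNReal.ofReal (I t) * rearr g t) *
              (dstar f t - rearr f t) := by ring
          _ ≤ _ := mul_le_mul' (mul_le_mul_right (hφge t ht.1) _) le_rfl
    _ = ⨆ n, ∫⁻ t in Set.Ioo (0:ℝ) 1, (ENNReal.ofReal t)⁻¹ * ψ n t * (dstar f t - rearr f t) := by
        apply lintegral_iSup
        · intro n
          exact (einv_measurable.mul (hψm n).measurable).mul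
            ((dstar_measurable f).sub (rearr_measurable f))
        · intro m n hmn t
          simp only [hψ]
          gcongr
    _ ≤ _ := iSup_le hn

end final

section lower

variable {I : ℝ → ℝ}

lemma cumul_double (g : ℝ → ℝ≥0∞) {a x : ℝ} (ha : 0 < a) (hax : a ≤ x) (hx : x ≤ 2 * a) :
    ∫⁻ s in Set.Ioo (0:ℝ) x, rearr g s ≤ 2 * ∫⁻ s in Set.Ioo (0:ℝ) a, rearr g s := by
  rcases hax.eq_or_lt with rfl | hlt
  · rw [two_mul]; exact le_self_add
  rw [lintegral_split _ ha hlt, two_mul]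
  refine add_le_add le_rfl ?_
  calc ∫⁻ r in Set.Ioo a x, rearr g r ≤ ∫⁻ r in Set.Ioo a x, rearr g a :=
        setLIntegral_mono' measurableSet_Ioo fun r hr => rearr_antitone g hr.1.le
    _ = rearr g a * ENNReal.ofReal (x - a) := by simp
    _ ≤ rearr g a * ENNReal.ofReal (a - 0) :=
        mul_le_mul_right (ENNReal.ofReal_le_ofReal (by linarith)) _
    _ = ∫⁻ r in Set.Ioo 0 a, rearr g a := by simp
    _ ≤ _ := setLIntegral_mono' measurableSet_Ioo fun r hr => rearr_antitone g hr.2.le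

lemma RI_mul (hqc : Quasiconcave I) (k : ℝ → ℝ≥0∞) {t : ℝ} (ht : t ∈ Set.Ioo (0:ℝ) 1) :
    ENNReal.ofReal (I t) * RI I k t = ∫⁻ s in Set.Ioo (0:ℝ) t, k s := by
  unfold RI
  rw [← mul_assoc, mul_comm (ENNReal.ofReal (I t)), J_inv_mul hqc ht, one_mul]

lemma RI_double (hqc : Quasiconcave I) (g : ℝ → ℝ≥0∞) :
    ∀ a x : ℝ, 0 < a → a ≤ x → x ≤ 2 * a → x < 1 →
      RI I (rearr g) x ≤ 2 * RI I (rearr g) a ∧ RI I (rearr g) a ≤ 2 * RI I (rearr g) x := by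
  intro a x ha hax hx hx1
  have haI : a ∈ Set.Ioo (0:ℝ) 1 := ⟨ha, hax.trans_lt hx1⟩
  have hxI : x ∈ Set.Ioo (0:ℝ) 1 := ⟨ha.trans_le hax, hx1⟩
  constructor
  · unfold RI
    calc _ ≤ (ENNReal.ofReal (I a))⁻¹ * (2 * ∫⁻ s in Set.Ioo (0:ℝ) a, rearr g s) :=
          mul_le_mul' (ENNReal.inv_le_inv.2 (J_mono hqc ha hax hx1)) (cumul_double g ha hax hx)
      _ = _ := by ring
  · have hJ : ENNReal.ofReal (I x) ≤ 2 * ENNReal.ofReal (I a) := by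
      rw [show (2 : ℝ≥0∞) = ENNReal.ofReal 2 by simp, ← ENNReal.ofReal_mul (by norm_num)]
      apply ENNReal.ofReal_le_ofReal
      have h1 := I_quasi hqc ha hax hx1
      have h2 := I_pos hqc haI
      have h3 : I x * a ≤ (2 * I a) * a := by nlinarith
      exact le_of_mul_le_mul_right h3 ha
    calc RI I (rearr g) a = (ENNReal.ofReal (I a))⁻¹ * ∫⁻ s in Set.Ioo (0:ℝ) a, rearr g s := rfl
      _ ≤ (ENNReal.ofReal (I a))⁻¹ * ∫⁻ s in Set.Ioo (0:ℝ) x, rearr g s :=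
          mul_le_mul_right (cumul_mono _ hax) _
      _ = (ENNReal.ofReal (I a))⁻¹ * (ENNReal.ofReal (I x) * RI I (rearr g) x) := by
          rw [RI_mul hqc _ hxI]
      _ ≤ (ENNReal.ofReal (I a))⁻¹ * ((2 * ENNReal.ofReal (I a)) * RI I (rearr g) x) :=
          mul_le_mul_right (mul_le_mul' hJ le_rfl) _
      _ = ((ENNReal.ofReal (I a))⁻¹ * ENNReal.ofReal (I a)) * (2 * RI I (rearr g) x) := by ring
      _ = _ := by rw [J_inv_mul hqc haI, one_mul]

lemma cumul_one_le (hqc : Quasiconcave I) {ρ : (ℝ → ℝ≥0∞) → ℝ≥0∞} (hρ : IsRiNorm ρ)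
    {g : ℝ → ℝ≥0∞} (hg : assoc ρ (RI I (rearr g)) ≤ 1) :
    ∫⁻ s in Set.Ioo (0:ℝ) 1, rearr g s ≤
      ENNReal.ofReal (4 * ((ρ (fun _ => 1)).toReal + 1)) := by
  obtain ⟨-, hhom, -, -, -, hfin, -, -⟩ := hρ
  set R := (ρ (fun _ => 1)).toReal with hR
  have hR0 : 0 ≤ R := ENNReal.toReal_nonneg
  have hR1 : 0 < R + 1 := by linarith
  set a : ℝ≥0∞ := ENNReal.ofReal (R + 1)⁻¹ with ha
  have ha' : a = (ENNReal.ofReal (R + 1))⁻¹ := ENNReal.ofReal_inv_of_pos hR1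
  set H := ∫⁻ s in Set.Ioo (0:ℝ) (1/2), rearr g s with hH
  have hadm : ρ (fun _ => a * 1) ≤ 1 := by
    rw [hhom (fun _ => 1) measurable_const _ (by positivity)]
    calc a * ρ (fun _ => 1) ≤ a * ENNReal.ofReal (R + 1) := by
          refine mul_le_mul_right ?_ _
          rw [← ENNReal.ofReal_toReal hfin.ne]
          exact ENNReal.ofReal_le_ofReal (by linarith)
      _ = 1 := by rw [ha', einv_mul hR1]
  have h1 : ∫⁻ t in Set.Ioo (0:ℝ) 1, RI I (rearr g) t * (a * 1) ≤ 1 := by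
    refine le_trans ?_ hg
    exact le_iSup₂ (f := fun (v : ℝ → ℝ≥0∞) (_ : Measurable v ∧ ρ v ≤ 1) =>
      ∫⁻ t in Set.Ioo (0:ℝ) 1, RI I (rearr g) t * v t) (fun _ => a * 1) ⟨measurable_const, hadm⟩
  have h2 : H * a * ENNReal.ofReal (1/2) ≤ 1 := by
    refine le_trans ?_ h1
    calc H * a * ENNReal.ofReal (1/2) = H * a * ENNReal.ofReal (1 - 1/2) := by norm_num
      _ = ∫⁻ t in Set.Ioo (1/2:ℝ) 1, H * a := by simp
      _ ≤ ∫⁻ t in Set.Ioo (1/2:ℝ) 1, RI I (rearr g) t * (a * 1) := by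
          refine setLIntegral_mono' measurableSet_Ioo fun t ht => ?_
          have htI : t ∈ Set.Ioo (0:ℝ) 1 := ⟨by linarith [ht.1], ht.2⟩
          rw [mul_one]
          refine mul_le_mul' ?_ le_rfl
          calc H ≤ ∫⁻ s in Set.Ioo (0:ℝ) t, rearr g s := cumul_mono _ ht.1.le
            _ = ENNReal.ofReal (I t) * RI I (rearr g) t := (RI_mul hqc _ htI).symm
            _ ≤ 1 * RI I (rearr g) t := by
                refine mul_le_mul' ?_ le_rfl
                rw [ENNReal.ofReal_le_one]; exact (I_lt_one hqc htI).le
            _ = _ := one_mul _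
      _ ≤ _ := lintegral_mono_set (Ioo_subset_Ioo (by norm_num) le_rfl)
  have h3 := cumul_double g (a := 1/2) (x := 1) (by norm_num) (by norm_num) (by norm_num)
  refine h3.trans ?_
  have hhalf : ENNReal.ofReal (1/2) * 2 = 1 := by
    rw [show (2 : ℝ≥0∞) = ENNReal.ofReal 2 by simp, ← ENNReal.ofReal_mul (by norm_num)]
    norm_num
  calc 2 * H = (H * a * ENNReal.ofReal (1/2)) * (2 * 2 * ENNReal.ofReal (R + 1)) := by
        calc 2 * H = 2 * H * (a * ENNReal.ofReal (R + 1)) * (ENNReal.ofReal (1/2) * 2) := by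
              rw [hhalf, ha', einv_mul hR1, mul_one, mul_one]
          _ = _ := by ring
    _ ≤ 1 * (2 * 2 * ENNReal.ofReal (R + 1)) := mul_le_mul' h2 le_rfl
    _ = _ := by
        rw [ENNReal.ofReal_mul (by norm_num)]; norm_num

lemma lower_bound (hqc : Quasiconcave I) {ρ : (ℝ → ℝ≥0∞) → ℝ≥0∞} (hρ : IsRiNorm ρ)
    {f g : ℝ → ℝ≥0∞} (hfin : ∫⁻ t in Set.Ioo (0:ℝ) 1, rearr f t ≠ ⊤)
    (hg : assoc ρ (RI I (rearr g)) ≤ 1) :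
    ∫⁻ t in Set.Ioo (0:ℝ) 1, rearr f t * rearr g t ≤
      16 * (⨆ (g : ℝ → ℝ≥0∞) (_ : Measurable g ∧ assoc ρ (SI I g) ≤ 1),
            ∫⁻ t in Set.Ioo (0:ℝ) 1,
              ENNReal.ofReal (I t / t) * (dstar f t - rearr f t) * rearr g t) +
      ENNReal.ofReal (4 * ((ρ (fun _ => 1)).toReal + 1)) *
        ∫⁻ t in Set.Ioo (0:ℝ) 1, rearr f t := by
  set u := RI I (rearr g) with hu
  set w : ℝ → ℝ≥0∞ := fun t => ⨆ r ∈ Set.Ico t 1, u r with hw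
  have hwanti : Antitone w := fun s t hst => biSup_mono fun r hr => ⟨hst.trans hr.1, hr.2⟩
  have huw : ∀ t r, t ≤ r → r < 1 → u r ≤ w t := fun t r h1 h2 =>
    le_iSup₂ (f := fun r (_ : r ∈ Set.Ico t 1) => u r) r ⟨h1, h2⟩
  set W : ℝ → ℝ≥0∞ := fun t => 16⁻¹ * w t with hW
  have hWanti : Antitone W := fun s t hst => mul_le_mul_right (hwanti hst) _
  have h16 : (16 : ℝ≥0∞)⁻¹ * 16 = 1 := ENNReal.inv_mul_cancel (by simp) (by simp)
  have hJw : ∀ s t, 0 < s → s ≤ t → t < 1 →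
      ENNReal.ofReal (I s) * w s ≤ ENNReal.ofReal (I t) * w t := by
    intro s t hs hst ht
    simp only [hw]
    rw [ENNReal.mul_iSup]
    refine iSup_le fun r => ?_
    rw [ENNReal.mul_iSup]
    refine iSup_le fun hr => ?_
    rcases le_total t r with h | h
    · exact mul_le_mul' (J_mono hqc hs hst ht) (huw t r h hr.2)
    · calc ENNReal.ofReal (I s) * u r ≤ ENNReal.ofReal (I r) * u r :=
            mul_le_mul' (J_mono hqc hs hr.1 hr.2) le_rfl
        _ = ∫⁻ s in Set.Ioo (0:ℝ) r, rearr g s := RI_mul hqc _ ⟨hs.trans_le hr.1, hr.2⟩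
        _ ≤ ∫⁻ s in Set.Ioo (0:ℝ) t, rearr g s := cumul_mono _ h
        _ = ENNReal.ofReal (I t) * u t := (RI_mul hqc _ ⟨hs.trans_le hst, ht⟩).symm
        _ ≤ _ := mul_le_mul_right (huw t t le_rfl ht) _
  have hSI : assoc ρ (SI I W) ≤ 1 := by
    calc assoc ρ (SI I W) ≤ assoc ρ (fun t => 16⁻¹ * w t) := by
          apply assoc_mono
          intro t ht
          unfold SI
          calc _ ≤ (ENNReal.ofReal (I t))⁻¹ * (16⁻¹ * (ENNReal.ofReal (I t) * w t)) := by
                refine mul_le_mul_right (iSup₂_le fun s hs => ?_) _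
                calc ENNReal.ofReal (I s) * rearr W s ≤ ENNReal.ofReal (I s) * W s :=
                      mul_le_mul_right (rearr_le_of_antitoneOn (hWanti.antitoneOn _)
                        ⟨hs.1, hs.2.trans_lt ht.2⟩) _
                  _ = 16⁻¹ * (ENNReal.ofReal (I s) * w s) := by simp only [hW]; ring
                  _ ≤ _ := mul_le_mul_right (hJw s t hs.1 hs.2 ht.2) _
            _ = ((ENNReal.ofReal (I t))⁻¹ * ENNReal.ofReal (I t)) * (16⁻¹ * w t) := by ring
            _ = _ := by rw [J_inv_mul hqc ht, one_mul]
      _ ≤ 16⁻¹ * assoc ρ w := assoc_const_mul_le (by simp)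
      _ ≤ 16⁻¹ * (16 * assoc ρ u) := mul_le_mul_right (transplant hρ (RI_double hqc g)) _
      _ = assoc ρ u := by rw [← mul_assoc, h16, one_mul]
      _ ≤ 1 := hg
  set X : ℝ → ℝ≥0∞ := fun t => (ENNReal.ofReal t)⁻¹ * (dstar f t - rearr f t) with hX
  have hXm : Measurable X := einv_measurable.mul ((dstar_measurable f).sub (rearr_measurable f))
  have hgm := rearr_measurable g
  set Λ := ∫⁻ t in Set.Ioo (0:ℝ) 1, rearr f t with hΛ
  calc ∫⁻ t in Set.Ioo (0:ℝ) 1, rearr f t * rearr g t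
      ≤ ∫⁻ s in Set.Ioo (0:ℝ) 1, (rearr g s * (∫⁻ r in Set.Ioo s 1, X r) + rearr g s * Λ) := by
        refine setLIntegral_mono' measurableSet_Ioo fun s hs => ?_
        rw [← mul_add, mul_comm]
        exact mul_le_mul_right ((rearr_le_dstar f hs.1).trans (dstar_le hfin hs)) _
    _ = (∫⁻ r in Set.Ioo (0:ℝ) 1, X r * ∫⁻ s in Set.Ioo (0:ℝ) r, rearr g s) +
          (∫⁻ s in Set.Ioo (0:ℝ) 1, rearr g s) * Λ := by
        rw [lintegral_add_right _ (hgm.mul_const _), lintegral_mul_const _ hgm,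
          tonelli_triangle hgm hXm]
    _ ≤ _ := by
        refine add_le_add ?_ (mul_le_mul' (cumul_one_le hqc hρ hg) le_rfl)
        calc ∫⁻ r in Set.Ioo (0:ℝ) 1, X r * ∫⁻ s in Set.Ioo (0:ℝ) r, rearr g s
            ≤ ∫⁻ t in Set.Ioo (0:ℝ) 1, 16 *
                (ENNReal.ofReal (I t / t) * (dstar f t - rearr f t) * rearr W t) := by
              apply lintegral_mono_ae
              filter_upwards [rearr_ae_eq_of_antitoneOn (hWanti.antitoneOn (Set.Ioo 0 1)),
                ae_restrict_mem measurableSet_Ioo] with t ht htI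
              rw [ht, ← RI_mul hqc _ htI, I_div htI.1]
              calc X t * (ENNReal.ofReal (I t) * RI I (rearr g) t)
                  ≤ X t * (ENNReal.ofReal (I t) * w t) :=
                    mul_le_mul_right (mul_le_mul_right (huw t t le_rfl htI.2) _) _
                _ = (16⁻¹ * 16) * (X t * (ENNReal.ofReal (I t) * w t)) := by rw [h16, one_mul]
                _ = _ := by simp only [hX, hW]; ring
          _ = 16 * ∫⁻ t in Set.Ioo (0:ℝ) 1,
                (ENNReal.ofReal (I t / t) * (dstar f t - rearr f t) * rearr W t) :=
              lintegral_const_mul' _ _ (by simp)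
          _ ≤ _ := by
              refine mul_le_mul_right ?_ _
              exact le_iSup₂ (f := fun (g : ℝ → ℝ≥0∞) (_ : Measurable g ∧ assoc ρ (SI I g) ≤ 1) =>
                ∫⁻ t in Set.Ioo (0:ℝ) 1,
                  ENNReal.ofReal (I t / t) * (dstar f t - rearr f t) * rearr g t) W
                ⟨hWanti.measurable, hSI⟩

end lower

/-- Proposition 4.11 / `prop:Norm1`.  For quasiconcave `I` satisfying (★)
and the maximal-operator condition, and an r.i. norm `‖·‖_X`,
`‖f‖_{Y_X} ≈ sup_{‖S_I g‖_{X'}≤1} ∫_0^1 (I(t)/t)(f^{**}(t)-f^*(t)) g^*(t) dt + ‖f‖₁`. -/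
theorem statement16 (I : ℝ → ℝ) (hqc : Quasiconcave I) (hstar : StarCond I)
    (hmax : MaxCond I) (ρ : (ℝ → ℝ≥0∞) → ℝ≥0∞) (hρ : IsRiNorm ρ) :
    ∃ c₁ c₂ : ℝ, 0 < c₁ ∧ 0 < c₂ ∧ ∀ f : ℝ → ℝ≥0∞, Measurable f →
      ENNReal.ofReal c₁ * optTargetNorm I ρ f ≤
          (⨆ (g : ℝ → ℝ≥0∞) (_ : Measurable g ∧ assoc ρ (SI I g) ≤ 1),
            ∫⁻ t in Set.Ioo (0:ℝ) 1,
              ENNReal.ofReal (I t / t) * (dstar f t - rearr f t) * rearr g t) + lOne f ∧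
        (⨆ (g : ℝ → ℝ≥0∞) (_ : Measurable g ∧ assoc ρ (SI I g) ≤ 1),
            ∫⁻ t in Set.Ioo (0:ℝ) 1,
              ENNReal.ofReal (I t / t) * (dstar f t - rearr f t) * rearr g t) + lOne f ≤
          ENNReal.ofReal c₂ * optTargetNorm I ρ f := by

  obtain ⟨cu, hcu, hup⟩ := upper_bound hqc hstar hmax ρ
  obtain ⟨cl, hcl, hlo⟩ := lOne_le hqc hρ
  set R := (ρ (fun _ => 1)).toReal with hR
  have hR0 : 0 ≤ R := ENNReal.toReal_nonneg
  have hB : 0 < 16 + 4 * (R + 1) := by linarith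
  refine ⟨(16 + 4 * (R + 1))⁻¹, cu + cl, by positivity, by positivity, fun f hf => ?_⟩
  set S := (⨆ (g : ℝ → ℝ≥0∞) (_ : Measurable g ∧ assoc ρ (SI I g) ≤ 1),
            ∫⁻ t in Set.Ioo (0:ℝ) 1,
              ENNReal.ofReal (I t / t) * (dstar f t - rearr f t) * rearr g t) with hS
  have hl1 := hlo f hf
  by_cases htop : lOne f = ⊤
  · rw [htop] at hl1 ⊢
    refine ⟨by simp, ?_⟩
    rw [add_top]
    refine hl1.trans ?_
    refine mul_le_mul' (ENNReal.ofReal_le_ofReal (by linarith)) le_rfl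
  · have hfin : ∫⁻ t in Set.Ioo (0:ℝ) 1, rearr f t ≠ ⊤ := by rwa [lintegral_rearr f hf]
    constructor
    · rw [ENNReal.ofReal_inv_of_pos hB]
      have h1 : optTargetNorm I ρ f ≤ ENNReal.ofReal (16 + 4 * (R + 1)) * (S + lOne f) := by
        unfold optTargetNorm
        refine iSup₂_le fun g hg => ?_
        refine (lower_bound hqc hρ hfin hg.2).trans ?_
        rw [lintegral_rearr f hf, mul_add _ S (lOne f)]
        refine add_le_add (mul_le_mul' ?_ le_rfl) (mul_le_mul' ?_ le_rfl)
        swap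
        · exact ENNReal.ofReal_le_ofReal (by linarith)
        rw [show (16 : ℝ≥0∞) = ENNReal.ofReal 16 by simp]
        exact ENNReal.ofReal_le_ofReal (by linarith)
      calc _ ≤ (ENNReal.ofReal (16 + 4 * (R + 1)))⁻¹ *
            (ENNReal.ofReal (16 + 4 * (R + 1)) * (S + lOne f)) := mul_le_mul_right h1 _
        _ = _ := by rw [← mul_assoc, einv_mul hB, one_mul]
    · rw [ENNReal.ofReal_add hcu.le hcl.le, add_mul]
      exact add_le_add (iSup₂_le fun g hg => hup f g hfin hg.2) hl1
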